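/- arXiv:1111.5448 — 2 statements merged into one kernel-verified Lean document; each statement's English description precedes it below -/
import Mathlib

section
/- Let B be a Birkhoff subcategory of a semi-abelian category A with reflector I : A → B. Then I preserves every pullback of a normal epimorphism along a split epimorphism; in particular, I preserves finite products. -/
open CategoryTheory CategoryTheory.Limits

universe v u v₂ u₂

namespace ProtoPaper

variable {C : Type u} [Category.{v} C]

section ZeroDefs

variable [HasZeroMorphisms C]

/-- `k` is a kernel of `f`. -/
def IsKernelOf {K A B : C} (k : K ⟶ A) (f : A ⟶ B) : Prop :=
  ∃ w : k ≫ f = 0, Nonempty (IsLimit (KernelFork.ofι k w))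

/-- `f` is a cokernel of `k`. -/
def IsCokernelOf {K A B : C} (f : A ⟶ B) (k : K ⟶ A) : Prop :=
  ∃ w : k ≫ f = 0, Nonempty (IsColimit (CokernelCofork.ofπ f w))

/-- A normal monomorphism: a kernel of some morphism. -/
def IsNormalMonoArrow {K A : C} (k : K ⟶ A) : Prop :=
  ∃ (B : C) (f : A ⟶ B), IsKernelOf k f

/-- A normal epimorphism: a cokernel of some morphism. -/
def IsNormalEpiArrow {A B : C} (f : A ⟶ B) : Prop :=
  ∃ (K : C) (k : K ⟶ A), IsCokernelOf f k

/-- A split short exact sequence `0 → K → A ⇄ B → 0`. -/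
structure IsSplitShortExact {K A B : C} (k : K ⟶ A) (f : A ⟶ B) (s : B ⟶ A) : Prop where
  isKernel : IsKernelOf k f
  split : s ≫ f = 𝟙 B

/-- A short exact sequence `0 → K → A → B → 0`. -/
structure IsShortExact {K A B : C} (k : K ⟶ A) (f : A ⟶ B) : Prop where
  isKernel : IsKernelOf k f
  isCokernel : IsCokernelOf f k

/-- A protosplit monomorphism: a kernel of a split epimorphism. -/
def IsProtosplitMono {K A : C} (k : K ⟶ A) : Prop :=
  ∃ (B : C) (f : A ⟶ B) (s : B ⟶ A), IsSplitShortExact k f s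

end ZeroDefs

/-- A pointed category is protomodular when the split short five lemma holds. -/
def IsProtomodular (C : Type u) [Category.{v} C] [HasZeroMorphisms C] : Prop :=
  ∀ ⦃K A B K' A' B' : C⦄ (k : K ⟶ A) (f : A ⟶ B) (s : B ⟶ A)
    (k' : K' ⟶ A') (f' : A' ⟶ B') (s' : B' ⟶ A')
    (κ : K ⟶ K') (α : A ⟶ A') (β : B ⟶ B'),
    IsSplitShortExact k f s → IsSplitShortExact k' f' s' →
    k ≫ α = κ ≫ k' → f ≫ β = α ≫ f' → s ≫ α = β ≫ s' →
    IsIso κ → IsIso β → IsIso α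

section Functors

variable {D : Type u₂} [Category.{v₂} D]

/-- A functor is protoadditive if it preserves split short exact sequences. -/
def IsProtoadditive [HasZeroMorphisms C] [HasZeroMorphisms D] (F : C ⥤ D) : Prop :=
  ∀ ⦃K A B : C⦄ (k : K ⟶ A) (f : A ⟶ B) (s : B ⟶ A),
    IsSplitShortExact k f s → IsSplitShortExact (F.map k) (F.map f) (F.map s)

/-- A functor preserves zero objects. -/
def PreservesZeroObjects (F : C ⥤ D) : Prop :=
  ∀ X : C, IsZero X → IsZero (F.obj X)

/-- A functor preserves pullbacks along split epimorphisms. -/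
def PreservesPullbacksAlongSplitEpis (F : C ⥤ D) : Prop :=
  ∀ ⦃P X Y Z : C⦄ (fst : P ⟶ X) (snd : P ⟶ Y) (f : X ⟶ Z) (g : Y ⟶ Z),
    IsSplitEpi f → IsPullback fst snd f g →
    IsPullback (F.map fst) (F.map snd) (F.map f) (F.map g)

end Functors

/-- A homological category: pointed, protomodular and regular (finitely complete with
pullback-stable (regular epi, mono) factorisations). -/
structure IsHomological (C : Type u) [Category.{v} C] [HasZeroObject C]
    [HasZeroMorphisms C] : Prop where
  protomodular : IsProtomodular C
  hasFiniteLimits : HasFiniteLimits C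
  regEpiMonoFac : ∀ ⦃X Y : C⦄ (f : X ⟶ Y),
    ∃ (I : C) (e : X ⟶ I) (m : I ⟶ Y), Nonempty (RegularEpi e) ∧ Mono m ∧ e ≫ m = f
  regEpiStable : ∀ ⦃P X Y Z : C⦄ (fst : P ⟶ X) (snd : P ⟶ Y) (f : X ⟶ Z) (g : Y ⟶ Z),
    IsPullback fst snd f g → Nonempty (RegularEpi f) → Nonempty (RegularEpi snd)

/-- An internal equivalence relation, given by a jointly monic pair which is internally
reflexive, symmetric and transitive. -/
structure IsInternalEquivRel {R X : C} (p₁ p₂ : R ⟶ X) : Prop where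
  jointlyMono : ∀ ⦃Z : C⦄ (a b : Z ⟶ R), a ≫ p₁ = b ≫ p₁ → a ≫ p₂ = b ≫ p₂ → a = b
  refl : ∃ d : X ⟶ R, d ≫ p₁ = 𝟙 X ∧ d ≫ p₂ = 𝟙 X
  symm : ∃ σ : R ⟶ R, σ ≫ p₁ = p₂ ∧ σ ≫ p₂ = p₁
  trans : ∀ ⦃P : C⦄ (q₁ q₂ : P ⟶ R), IsPullback q₁ q₂ p₂ p₁ →
    ∃ t : P ⟶ R, t ≫ p₁ = q₁ ≫ p₁ ∧ t ≫ p₂ = q₂ ≫ p₂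

/-- A semi-abelian category: homological, with binary coproducts, and exact
(every internal equivalence relation is a kernel pair). -/
structure IsSemiAbelian (C : Type u) [Category.{v} C] [HasZeroObject C]
    [HasZeroMorphisms C] : Prop where
  homological : IsHomological C
  hasBinaryCoproducts : HasBinaryCoproducts C
  equivRelEffective : ∀ ⦃R X : C⦄ (p₁ p₂ : R ⟶ X), IsInternalEquivRel p₁ p₂ →
    ∃ (Y : C) (f : X ⟶ Y), IsPullback p₁ p₂ f f

/-- A full subcategory (given by a predicate on objects) is replete if it is closed
under isomorphisms. -/
def Replete (P : C → Prop) : Prop := ∀ ⦃X Y : C⦄, P X → (X ≅ Y) → P Y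

/-- A reflection of `C` onto the full subcategory of objects satisfying `P`:
a reflector `F`, a unit `η`, landing in `P`, with the usual universal property. -/
structure Reflection (C : Type u) [Category.{v} C] (P : C → Prop) where
  F : C ⥤ C
  η : 𝟭 C ⟶ F
  mem : ∀ X : C, P (F.obj X)
  univ : ∀ ⦃X B : C⦄, P B → ∀ f : X ⟶ B, ∃! g : F.obj X ⟶ B, η.app X ≫ g = f

variable {P : C → Prop}

/-- A (normal epi)-reflection: all units are normal epimorphisms. -/
def NormalEpiUnits [HasZeroMorphisms C] (R : Reflection C P) : Prop :=
  ∀ X : C, IsNormalEpiArrow (R.η.app X)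

/-- `f` is a trivial extension with respect to the reflection `R`. -/
def IsTrivialExt (R : Reflection C P) {A B : C} (f : A ⟶ B) : Prop :=
  IsPullback (R.η.app A) f (R.F.map f) (R.η.app B)

/-- `p` is an effective descent morphism: the pullback functor between the slice
categories is monadic. -/
def IsEffectiveDescent [HasPullbacks C] {E B : C} (p : E ⟶ B) : Prop :=
  Nonempty (MonadicRightAdjoint (Over.pullback p))

/-- A central extension with respect to the (absolute) Galois structure of a reflection:
some pullback along an effective descent morphism is a trivial extension. -/
def IsCentralExt [HasPullbacks C] (R : Reflection C P) {A B : C} (f : A ⟶ B) : Prop :=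
  ∃ (E : C) (p : E ⟶ B), IsEffectiveDescent p ∧
    ∃ (Pb : C) (p1 : Pb ⟶ E) (p2 : Pb ⟶ A), IsPullback p1 p2 p f ∧ IsTrivialExt R p1

/-- A normal extension with respect to the (absolute) Galois structure of a reflection. -/
def IsNormalExt [HasPullbacks C] (R : Reflection C P) {A B : C} (f : A ⟶ B) : Prop :=
  IsEffectiveDescent f ∧
    ∃ (Pb : C) (p1 p2 : Pb ⟶ A), IsPullback p1 p2 f f ∧ IsTrivialExt R p1

/-- A central extension with respect to the Galois structure of a reflection relative to
the class of normal epimorphisms. -/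
def IsCentralExtN [HasZeroMorphisms C] (R : Reflection C P) {A B : C} (f : A ⟶ B) : Prop :=
  IsNormalEpiArrow f ∧ ∃ (E : C) (p : E ⟶ B), IsNormalEpiArrow p ∧
    ∃ (Pb : C) (p1 : Pb ⟶ E) (p2 : Pb ⟶ A), IsPullback p1 p2 p f ∧ IsTrivialExt R p1

/-- A normal extension with respect to the Galois structure of a reflection relative to
the class of normal epimorphisms. -/
def IsNormalExtN [HasZeroMorphisms C] (R : Reflection C P) {A B : C} (f : A ⟶ B) : Prop :=
  IsNormalEpiArrow f ∧
    ∃ (Pb : C) (p1 p2 : Pb ⟶ A), IsPullback p1 p2 f f ∧ IsTrivialExt R p1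

/-- The reflector is semi-left-exact: it preserves pullbacks of units along morphisms
with domain in the subcategory. -/
def SemiLeftExact (R : Reflection C P) : Prop :=
  ∀ ⦃A X Pb : C⦄ (x : X ⟶ R.F.obj A) (p1 : Pb ⟶ A) (p2 : Pb ⟶ X), P X →
    IsPullback p1 p2 (R.η.app A) x →
    IsPullback (R.F.map p1) (R.F.map p2) (R.F.map (R.η.app A)) (R.F.map x)

/-- The reflector has stable units: it preserves pullbacks of units along arbitrary
morphisms. -/
def StableUnits (R : Reflection C P) : Prop :=
  ∀ ⦃A X Pb : C⦄ (x : X ⟶ R.F.obj A) (p1 : Pb ⟶ A) (p2 : Pb ⟶ X),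
    IsPullback p1 p2 (R.η.app A) x →
    IsPullback (R.F.map p1) (R.F.map p2) (R.F.map (R.η.app A)) (R.F.map x)

/-- The reflection is admissible with respect to the class of normal epimorphisms:
the reflector preserves pullbacks of units along normal epimorphisms with domain in
the subcategory. -/
def AdmissibleN [HasZeroMorphisms C] (R : Reflection C P) : Prop :=
  ∀ ⦃A X Pb : C⦄ (x : X ⟶ R.F.obj A) (p1 : Pb ⟶ A) (p2 : Pb ⟶ X), P X →
    IsNormalEpiArrow x →
    IsPullback p1 p2 (R.η.app A) x →
    IsPullback (R.F.map p1) (R.F.map p2) (R.F.map (R.η.app A)) (R.F.map x)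

/-- The radical associated to a (normal epi)-reflection is idempotent. -/
def IdempotentRadical [HasZeroMorphisms C] (R : Reflection C P) : Prop :=
  ∀ ⦃A TA : C⦄ (t : TA ⟶ A), IsKernelOf t (R.η.app A) →
    ∀ ⦃T2 : C⦄ (t2 : T2 ⟶ TA), IsKernelOf t2 (R.η.app TA) → IsIso t2

/-- Condition (N) for a (normal epi)-reflection: for any morphism `f` with kernel
`k : K ⟶ A`, and any kernel `t : TK ⟶ K` of the unit at `K`, the composite `t ≫ k`
is a normal monomorphism. -/
def ConditionN [HasZeroMorphisms C] (R : Reflection C P) : Prop :=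
  ∀ ⦃A B : C⦄ (f : A ⟶ B) ⦃K : C⦄ (k : K ⟶ A), IsKernelOf k f →
    ∀ ⦃TK : C⦄ (t : TK ⟶ K), IsKernelOf t (R.η.app K) → IsNormalMonoArrow (t ≫ k)

/-- A torsion theory on a pointed category, given by a pair of full replete
subcategories. -/
structure TorsionTheory (C : Type u) [Category.{v} C] [HasZeroMorphisms C]
    (T F : C → Prop) : Prop where
  repleteT : Replete T
  repleteF : Replete F
  hom_zero : ∀ ⦃X Y : C⦄ (f : X ⟶ Y), T X → F Y → f = 0
  exists_ses : ∀ A : C, ∃ (TA FA : C) (t : TA ⟶ A) (q : A ⟶ FA),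
    T TA ∧ F FA ∧ IsShortExact t q

/-- Condition (N) for a torsion theory, formulated without reference to a chosen
reflector: for any morphism `f` with kernel `k : K ⟶ A` and any short exact sequence
`0 → TK → K → FK → 0` with `TK` torsion and `FK` torsion-free, the composite
`TK → A` is a normal monomorphism. -/
def TTConditionN [HasZeroMorphisms C] (T F : C → Prop) : Prop :=
  ∀ ⦃A B K TK FK : C⦄ (f : A ⟶ B) (k : K ⟶ A) (t : TK ⟶ K) (q : K ⟶ FK),
    IsKernelOf k f → T TK → F FK → IsShortExact t q → IsNormalMonoArrow (t ≫ k)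

/-- Condition (P) for a torsion theory: the torsion-free reflector is protoadditive
(formulated for every (normal epi)-reflection onto the torsion-free part). -/
def TTConditionP [HasZeroMorphisms C] (T F : C → Prop) : Prop :=
  ∀ R : Reflection C F, NormalEpiUnits R → IsProtoadditive R.F

/-- Orthogonality `e ↓ m` of two morphisms. -/
def Orthogonal {A B X Y : C} (e : A ⟶ B) (m : X ⟶ Y) : Prop :=
  ∀ (a : A ⟶ X) (b : B ⟶ Y), e ≫ b = a ≫ m →
    ∃! d : B ⟶ X, e ≫ d = a ∧ d ≫ m = b

/-- The class of morphisms orthogonal on the right to all members of `E`. -/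
def dnOrth (E : MorphismProperty C) : MorphismProperty C :=
  fun _ _ m => ∀ ⦃A B : C⦄ (e : A ⟶ B), E e → Orthogonal e m

/-- The class of morphisms orthogonal on the left to all members of `M`. -/
def upOrth (M : MorphismProperty C) : MorphismProperty C :=
  fun _ _ e => ∀ ⦃X Y : C⦄ (m : X ⟶ Y), M m → Orthogonal e m

/-- A prefactorisation system. -/
structure IsPrefactorisationSystem (E M : MorphismProperty C) : Prop where
  E_eq : E = upOrth M
  M_eq : M = dnOrth E

/-- A factorisation system. -/
structure IsFactorisationSystem (E M : MorphismProperty C) : Prop where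
  E_eq : E = upOrth M
  M_eq : M = dnOrth E
  fac : ∀ ⦃X Y : C⦄ (f : X ⟶ Y),
    ∃ (I : C) (e : X ⟶ I) (m : I ⟶ Y), E e ∧ M m ∧ e ≫ m = f

/-- A pullback-stable class of morphisms. -/
def PullbackStable (E : MorphismProperty C) : Prop :=
  ∀ ⦃P X Y Z : C⦄ (fst : P ⟶ X) (snd : P ⟶ Y) (f : X ⟶ Z) (g : Y ⟶ Z),
    IsPullback fst snd f g → E f → E snd

/-- The class of morphisms inverted by the reflector. -/
def invertedByR (R : Reflection C P) : MorphismProperty C :=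
  fun _ _ f => IsIso (R.F.map f)

/-- The class of morphisms all of whose pullbacks lie in `E` ("stably in `E`"). -/
def StablyIn (E : MorphismProperty C) : MorphismProperty C :=
  fun _ Y e => ∀ ⦃Pb W : C⦄ (fst : Pb ⟶ W) (snd : Pb ⟶ _) (g : W ⟶ Y),
    IsPullback fst snd g e → E fst

/-- The class of morphisms locally in `M`: some pullback along an effective descent
morphism lies in `M`. -/
def locallyIn [HasPullbacks C] (M : MorphismProperty C) : MorphismProperty C :=
  fun _ B f => ∃ (E : C) (p : E ⟶ B), IsEffectiveDescent p ∧
    ∃ (Pb : C) (p1 : Pb ⟶ E) (p2 : Pb ⟶ _), IsPullback p1 p2 p f ∧ M p1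

/-- The class `Ē` associated to a torsion theory: normal epimorphisms with torsion
kernel. -/
def Ebar [HasZeroMorphisms C] (T : C → Prop) : MorphismProperty C :=
  fun X _ e => IsNormalEpiArrow e ∧ ∃ (K : C) (k : K ⟶ X), IsKernelOf k e ∧ T K

/-- The class `M̄` associated to a torsion theory: morphisms with torsion-free
kernel. -/
def Mbar [HasZeroMorphisms C] (F : C → Prop) : MorphismProperty C :=
  fun X _ m => ∃ (K : C) (k : K ⟶ X), IsKernelOf k m ∧ F K

/-- A Birkhoff subcategory: a (regular epi)-reflective subcategory such that the
naturality squares of the unit at regular epimorphisms are pushouts. -/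
structure IsBirkhoff [HasZeroMorphisms C] (R : Reflection C P) : Prop where
  units_regEpi : ∀ X : C, Nonempty (RegularEpi (R.η.app X))
  pushout_units : ∀ ⦃A B : C⦄ (f : A ⟶ B), Nonempty (RegularEpi f) →
    IsPushout f (R.η.app A) (R.η.app B) (R.F.map f)

section ArrowInstances

variable [HasZeroMorphisms C]

instance instZeroArrowHom (f g : Arrow C) : Zero (f ⟶ g) :=
  ⟨{ left := 0, right := 0, w := by simp }⟩

@[simp] lemma arrowHomZero_left (f g : Arrow C) : (0 : f ⟶ g).left = 0 := rfl

@[simp] lemma arrowHomZero_right (f g : Arrow C) : (0 : f ⟶ g).right = 0 := rfl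

instance instArrowHasZeroMorphisms : HasZeroMorphisms (Arrow C) where
  comp_zero {X Y} f Z := by
    apply CommaMorphism.ext <;> simp
  zero_comp X {Y Z} f := by
    apply CommaMorphism.ext <;> simp

end ArrowInstances

section Helpers

variable {C : Type u} [Category.{v} C]

lemma strongEpi_of_reg {X Y : C} {f : X ⟶ Y} (h : Nonempty (RegularEpi f)) : StrongEpi f := by
  obtain ⟨h⟩ := h
  have := isRegularEpi_of_regularEpi h
  infer_instance

attribute [local simp] prod.lift_fst prod.lift_snd pullback.lift_fst pullback.lift_snd prod.lift_fst_assoc prod.lift_snd_assoc pullback.lift_fst_assoc pullback.lift_snd_assoc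

variable [HasZeroObject C] [HasZeroMorphisms C]

lemma reg_of_normal {X Y : C} {f : X ⟶ Y} (h : IsNormalEpiArrow f) : Nonempty (RegularEpi f) := by
  obtain ⟨K, k, w, ⟨hc⟩⟩ := h
  exact ⟨⟨K, k, 0, by simpa using w, hc⟩⟩

lemma reg_of_strongEpi (hH : IsHomological C) {X Y : C} (f : X ⟶ Y) [StrongEpi f] :
    Nonempty (RegularEpi f) := by
  obtain ⟨I, e, m, ⟨he⟩, hm, rfl⟩ := hH.regEpiMonoFac f
  have : StrongEpi m := strongEpi_of_strongEpi e m
  have : IsIso m := isIso_of_mono_of_strongEpi m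
  refine ⟨⟨he.W, he.left, he.right, by simp [he.w_assoc], ?_⟩⟩
  refine Cofork.IsColimit.mk' _ fun s => ?_
  obtain ⟨l, hl⟩ := he.desc' s.π s.condition
  have : Epi e := (strongEpi_of_reg ⟨he⟩).epi
  refine ⟨inv m ≫ l, by simpa using hl, ?_⟩
  intro l' hl'
  rw [← cancel_epi m, ← cancel_epi e]
  simp only [Cofork.π_ofπ, Category.assoc] at hl'
  simp [hl, hl']

lemma strongEpi_stable (hH : IsHomological C) {P X Y Z : C} {fst : P ⟶ X} {snd : P ⟶ Y}
    {f : X ⟶ Z} {g : Y ⟶ Z} (h : IsPullback fst snd f g) [StrongEpi f] : StrongEpi snd :=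
  strongEpi_of_reg (hH.regEpiStable fst snd f g h (reg_of_strongEpi hH f))

/-- Split version of the short five lemma for a monomorphism. -/
lemma iso_of_split (hP : IsProtomodular C) [HasKernels C] {J T B : C} (m : J ⟶ T) [Mono m]
    (q : T ⟶ B) (s : B ⟶ J) (hs : s ≫ m ≫ q = 𝟙 B)
    (hk : ∀ ⦃Z : C⦄ (z : Z ⟶ T), z ≫ q = 0 → ∃ w : Z ⟶ J, w ≫ m = z) : IsIso m := by
  obtain ⟨l, hl⟩ := hk (kernel.ι q) (kernel.condition q)
  have hlm : Mono l := by
    have : Mono (l ≫ m) := by rw [hl]; infer_instance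
    exact mono_of_mono l m
  refine hP l (m ≫ q) s (kernel.ι q) q (s ≫ m) (𝟙 _) m (𝟙 _) ⟨⟨?_, ⟨?_⟩⟩, hs⟩
    ⟨⟨kernel.condition q, ⟨kernelIsKernel q⟩⟩, by simpa using hs⟩ (by simpa using hl)
    (by simp) (by simp) inferInstance inferInstance
  · rw [← Category.assoc, hl, kernel.condition]
  · refine KernelFork.IsLimit.ofι' l _ fun {W} k hk' =>
      ⟨kernel.lift q (k ≫ m) (by simpa using hk'), ?_⟩
    rw [← cancel_mono m, Category.assoc, hl, kernel.lift_ι]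

lemma mono_of_ker (hP : IsProtomodular C) [HasPullbacks C] [HasKernels C] {A B : C} (f : A ⟶ B)
    (h : ∀ ⦃Z : C⦄ (z : Z ⟶ A), z ≫ f = 0 → z = 0) : Mono f := by
  have hd : IsIso (pullback.diagonal f) := by
    refine iso_of_split hP (pullback.diagonal f) (pullback.fst f f) (𝟙 _) (by simp) ?_
    intro Z z hz
    refine ⟨0, ?_⟩
    have h2 : z ≫ pullback.snd f f = 0 := by
      apply h
      rw [Category.assoc, ← pullback.condition, ← Category.assoc, hz, zero_comp]
    apply pullback.hom_ext <;> simp [hz, h2]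
  have e : pullback.fst f f = pullback.snd f f := by
    rw [← cancel_epi (pullback.diagonal f)]; simp
  constructor
  intro Z a b hab
  have := pullback.lift a b hab ≫= e
  simpa using this

/-- Short five lemma for a monomorphism. -/
lemma iso_of_strong (hH : IsHomological C) [HasPullbacks C] [HasKernels C] {J T B : C}
    (m : J ⟶ T) [Mono m] (q : T ⟶ B) [StrongEpi (m ≫ q)]
    (hk : ∀ ⦃Z : C⦄ (z : Z ⟶ T), z ≫ q = 0 → ∃ w : Z ⟶ J, w ≫ m = z) : IsIso m := by
  let t := pullback.snd (m ≫ q) q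
  have ht : StrongEpi t := strongEpi_stable hH (IsPullback.of_hasPullback (m ≫ q) q)
  have hm : IsIso (pullback.snd m t) := by
    refine iso_of_split hH.protomodular (pullback.snd m t) (pullback.fst (m ≫ q) q)
      (pullback.lift (𝟙 _) (pullback.lift (𝟙 _) m (by simp)) (by simp [t])) (by simp) ?_
    intro Z z hz
    obtain ⟨w, hw⟩ := hk (z ≫ t) (by
      rw [Category.assoc, ← pullback.condition, ← Category.assoc, hz, zero_comp])
    exact ⟨pullback.lift w z hw, by simp⟩
  have : StrongEpi (pullback.fst m t ≫ m) := by
    rw [pullback.condition]; infer_instance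
  have : StrongEpi m := strongEpi_of_strongEpi (pullback.fst m t) m
  exact isIso_of_mono_of_strongEpi m

lemma trans_of_refl (hH : IsHomological C) [HasFiniteLimits C] {S X : C} (p₁ p₂ : S ⟶ X)
    (hj : ∀ ⦃Z : C⦄ (a b : Z ⟶ S), a ≫ p₁ = b ≫ p₁ → a ≫ p₂ = b ≫ p₂ → a = b)
    (d : X ⟶ S) (h1 : d ≫ p₁ = 𝟙 X) (h2 : d ≫ p₂ = 𝟙 X)
    {P : C} (q₁ q₂ : P ⟶ S) (h : IsPullback q₁ q₂ p₂ p₁) :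
    ∃ t : P ⟶ S, t ≫ p₁ = q₁ ≫ p₁ ∧ t ≫ p₂ = q₂ ≫ p₂ := by
  let n : S ⟶ X ⨯ X := prod.lift p₁ p₂
  let r : P ⟶ X ⨯ X := prod.lift (q₁ ≫ p₁) (q₂ ≫ p₂)
  have hn : Mono n := by
    constructor
    intro Z a b hab
    apply hj
    · simpa [n] using hab =≫ prod.fst
    · simpa [n] using hab =≫ prod.snd
  let iA : S ⟶ P := h.lift (𝟙 _) (p₂ ≫ d) (by simp [h1])
  let iC : S ⟶ P := h.lift (p₁ ≫ d) (𝟙 _) (by simp [h2])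
  have hA : 𝟙 _ ≫ n = iA ≫ r := by
    apply Limits.prod.hom_ext
    · simp [n, r, iA]
    · simp [n, r, iA, h2]
  have hC : 𝟙 _ ≫ n = iC ≫ r := by
    apply Limits.prod.hom_ext
    · simp [n, r, iC, h1]
    · simp [n, r, iC]
  have hm : IsIso (pullback.snd n r) := by
    refine iso_of_split hH.protomodular (pullback.snd n r) q₂ (pullback.lift _ _ hC)
      (by simp [iC]) ?_
    intro Z z hz
    refine ⟨z ≫ q₁ ≫ pullback.lift _ _ hA, ?_⟩
    simp only [Category.assoc, pullback.lift_snd]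
    apply h.hom_ext
    · simp [iA]
    · have : z ≫ q₁ ≫ p₂ = 0 := by
        rw [h.w, ← Category.assoc, hz, zero_comp]
      simp only [iA, Category.assoc, IsPullback.lift_snd, hz]
      rw [← Category.assoc, ← Category.assoc, Category.assoc z, this, zero_comp]
  have key : inv (pullback.snd n r) ≫ pullback.fst n r ≫ n = r := by
    rw [pullback.condition]; simp
  refine ⟨inv (pullback.snd n r) ≫ pullback.fst n r, ?_, ?_⟩
  · simpa [n, r] using key =≫ prod.fst
  · simpa [n, r] using key =≫ prod.snd

/-- In a pushout of regular epimorphisms, the induced map of kernel pairs is a strong epi. -/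
lemma kernelPair_strong (hC : IsSemiAbelian C) [HasFiniteLimits C] {A B X D : C}
    {f : A ⟶ B} {h : A ⟶ X} {h' : B ⟶ D} {f' : X ⟶ D}
    (hf : Nonempty (RegularEpi f)) [StrongEpi h] (hpo : IsPushout f h h' f') :
    ∀ φ : pullback f f ⟶ pullback f' f',
      φ ≫ pullback.fst f' f' = pullback.fst f f ≫ h →
      φ ≫ pullback.snd f' f' = pullback.snd f f ≫ h → StrongEpi φ := by
  intro φ hφ1 hφ2
  have hH := hC.homological
  obtain ⟨S, e, m, he, hm, hem⟩ := hH.regEpiMonoFac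
    (prod.lift (pullback.fst f f ≫ h) (pullback.snd f f ≫ h))
  have he := strongEpi_of_reg he
  let s₁ := m ≫ prod.fst
  let s₂ := m ≫ prod.snd
  have e1 : e ≫ s₁ = pullback.fst f f ≫ h := by simp [s₁, ← Category.assoc, hem]
  have e2 : e ≫ s₂ = pullback.snd f f ≫ h := by simp [s₂, ← Category.assoc, hem]
  have hj : ∀ ⦃Z : C⦄ (a b : Z ⟶ S), a ≫ s₁ = b ≫ s₁ → a ≫ s₂ = b ≫ s₂ → a = b := by
    intro Z a b h1 h2
    rw [← cancel_mono m]
    apply Limits.prod.hom_ext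
    · simpa [s₁] using h1
    · simpa [s₂] using h2
  have sqd : CommSq (pullback.diagonal f ≫ e) h m (prod.lift (𝟙 _) (𝟙 _)) := by
    constructor
    rw [Category.assoc, hem]
    apply Limits.prod.hom_ext <;> simp
  have d1 : sqd.lift ≫ s₁ = 𝟙 _ := by simp [s₁, ← Category.assoc]
  have d2 : sqd.lift ≫ s₂ = 𝟙 _ := by simp [s₂, ← Category.assoc]
  have sqs : CommSq
      (pullback.lift (pullback.snd f f) (pullback.fst f f) pullback.condition.symm ≫ e) e m
      (prod.lift s₂ s₁) := by
    constructor
    rw [Category.assoc, hem]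
    apply Limits.prod.hom_ext
    · simp [e2]
    · simp [e1]
  have σ1 : sqs.lift ≫ s₁ = s₂ := by simp [s₁, ← Category.assoc]
  have σ2 : sqs.lift ≫ s₂ = s₁ := by simp [s₂, ← Category.assoc]
  obtain ⟨E, q, hq⟩ := hC.equivRelEffective s₁ s₂
    ⟨hj, ⟨_, d1, d2⟩, ⟨_, σ1, σ2⟩,
      fun _ q₁ q₂ hp => trans_of_refl hH s₁ s₂ hj _ d1 d2 q₁ q₂ hp⟩
  obtain ⟨rf⟩ := hf
  obtain ⟨b, hb⟩ := rf.desc' (h ≫ q) (by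
    have h1 := pullback.lift rf.left rf.right rf.w ≫= e1
    have h2 := pullback.lift rf.left rf.right rf.w ≫= e2
    rw [pullback.lift_fst_assoc] at h1
    rw [pullback.lift_snd_assoc] at h2
    rw [← Category.assoc, ← h1, ← Category.assoc rf.right, ← h2]
    simp [hq.w])
  let d : D ⟶ E := hpo.desc b q hb
  have hd : f' ≫ d = q := by simp [d]
  have hl : pullback.fst f' f' ≫ q = pullback.snd f' f' ≫ q := by
    rw [← hd, pullback.condition_assoc]
  let l : pullback f' f' ⟶ S := hq.lift _ _ hl
  have hS : s₁ ≫ f' = s₂ ≫ f' := by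
    rw [← cancel_epi e, ← Category.assoc, e1, ← Category.assoc, e2, Category.assoc, Category.assoc,
      ← hpo.w, pullback.condition_assoc]
  have hi : IsIso (pullback.lift s₁ s₂ hS) := by
    refine ⟨l, ?_, ?_⟩
    · apply hj <;> simp [l]
    · apply pullback.hom_ext <;> simp [l]
  have : φ = e ≫ pullback.lift s₁ s₂ hS := by
    apply pullback.hom_ext <;> simp [hφ1, hφ2, e1, e2]
  rw [this]
  infer_instance

lemma kernel_strong (hC : IsSemiAbelian C) [HasFiniteLimits C] {A B X D : C}
    {f : A ⟶ B} {h : A ⟶ X} {h' : B ⟶ D} {f' : X ⟶ D}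
    (hf : Nonempty (RegularEpi f)) [StrongEpi h] (hpo : IsPushout f h h' f')
    {K K' : C} (k : K ⟶ A) [Mono k] (hkf : k ≫ f = 0)
    (hk : ∀ ⦃Z : C⦄ (z : Z ⟶ A), z ≫ f = 0 → ∃ w : Z ⟶ K, w ≫ k = z)
    (k' : K' ⟶ X) [Mono k'] (hkf' : k' ≫ f' = 0) (κ : K ⟶ K') (hκ : κ ≫ k' = k ≫ h) :
    StrongEpi κ := by
  have hH := hC.homological
  let φ : pullback f f ⟶ pullback f' f' :=
    pullback.lift (pullback.fst f f ≫ h) (pullback.snd f f ≫ h) (by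
      rw [Category.assoc, Category.assoc, ← hpo.w, pullback.condition_assoc])
  have φ1 : φ ≫ pullback.fst f' f' = pullback.fst f f ≫ h := by simp [φ]
  have φ2 : φ ≫ pullback.snd f' f' = pullback.snd f f ≫ h := by simp [φ]
  have hφ : StrongEpi φ := kernelPair_strong hC hf hpo φ φ1 φ2
  let c : pullback f f ⟶ pullback h (pullback.fst f' f') :=
    pullback.lift (pullback.fst f f) φ φ1.symm
  have c1 : c ≫ pullback.fst _ _ = pullback.fst f f := by simp [c]
  have c2 : c ≫ pullback.snd _ _ = φ := by simp [c]
  have hc : StrongEpi c := by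
    obtain ⟨J, e, m, he, hm, hem⟩ := hH.regEpiMonoFac c
    have he := strongEpi_of_reg he
    have : StrongEpi (e ≫ m ≫ pullback.snd h (pullback.fst f' f')) := by
      rw [← Category.assoc, hem, c2]; exact hφ
    have : StrongEpi (m ≫ pullback.snd h (pullback.fst f' f')) := strongEpi_of_strongEpi e _
    have : IsIso m := by
      refine iso_of_strong hH m (pullback.snd h (pullback.fst f' f')) ?_
      intro Z z hz
      refine ⟨z ≫ pullback.fst _ _ ≫ pullback.diagonal f ≫ e, ?_⟩
      have hz0 : z ≫ pullback.fst h (pullback.fst f' f') ≫ h = 0 := by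
        rw [pullback.condition, ← Category.assoc, hz, zero_comp]
      simp only [Category.assoc, hem]
      apply pullback.hom_ext
      · simp [c1]
      · simp only [Category.assoc, c2, hz]
        apply pullback.hom_ext
        · simp [φ1, hz0]
        · simp [φ2, hz0]
    rw [← hem]; infer_instance
  let j : K' ⟶ pullback h (pullback.fst f' f') :=
    pullback.lift 0 (pullback.lift 0 k' (by simp [hkf'])) (by simp)
  have hpb : IsPullback (pullback.lift 0 k (by simp [hkf])) κ c j := by
    have h00 : ∀ s : PullbackCone c j, s.fst ≫ pullback.fst f f = 0 := by
      intro s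
      have := s.condition =≫ pullback.fst _ _
      simpa [c1, j] using this
    have hex : ∀ s : PullbackCone c j, ∃ w : s.pt ⟶ K, w ≫ k = s.fst ≫ pullback.snd f f := by
      intro s
      apply hk
      rw [Category.assoc, ← pullback.condition, ← Category.assoc, h00, zero_comp]
    choose L hL using hex
    refine ⟨⟨?_⟩, ⟨PullbackCone.IsLimit.mk _ L ?_ ?_ ?_⟩⟩
    · apply pullback.hom_ext
      · simp [c1, j]
      · apply pullback.hom_ext
        · simp [c2, j, φ1]
        · simp [c2, j, φ2, hκ]
    · intro s
      apply pullback.hom_ext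
      · simp [h00]
      · simpa using hL s
    · intro s
      rw [← cancel_mono k', Category.assoc, hκ, ← Category.assoc, hL]
      have := (s.condition =≫ pullback.snd _ _) =≫ pullback.snd _ _
      simpa [c2, j, φ2] using this
    · intro s w h1 h2
      rw [← cancel_mono k, hL, ← h1]
      simp
  exact strongEpi_stable hH hpb

end Helpers

/-- Lemma 5.2. The reflector onto a Birkhoff subcategory of a
semi-abelian category preserves pullbacks of normal epimorphisms along split
epimorphisms; in particular, it preserves finite products. -/
theorem statement17 {C : Type u} [Category.{v} C] [HasZeroObject C] [HasZeroMorphisms C]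
    (hC : IsSemiAbelian C) {P : C → Prop} (hrepl : Replete P)
    (R : Reflection C P) (hB : IsBirkhoff R) :
    (∀ ⦃Pb X Y Z : C⦄ (fst : Pb ⟶ X) (snd : Pb ⟶ Y) (f : X ⟶ Z) (g : Y ⟶ Z),
      IsSplitEpi f → IsNormalEpiArrow g → IsPullback fst snd f g →
      IsPullback (R.F.map fst) (R.F.map snd) (R.F.map f) (R.F.map g))
    ∧ PreservesFiniteProducts R.F := by
  have hH := hC.homological
  have := hH.hasFiniteLimits
  have hη : ∀ X : C, StrongEpi (R.η.app X) := fun X => strongEpi_of_reg (hB.units_regEpi X)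
  have main : ∀ ⦃Pb X Y Z : C⦄ (fst : Pb ⟶ X) (snd : Pb ⟶ Y) (f : X ⟶ Z) (g : Y ⟶ Z),
      IsSplitEpi f → IsNormalEpiArrow g → IsPullback fst snd f g →
      IsPullback (R.F.map fst) (R.F.map snd) (R.F.map f) (R.F.map g) := by
    intro Pb X Y Z fst snd f g hf hg hpb
    have hg := reg_of_normal hg
    have hfst : Nonempty (RegularEpi fst) := hH.regEpiStable _ _ _ _ hpb.flip hg
    have hfst' : StrongEpi fst := strongEpi_of_reg hfst
    have nat : ∀ {U V : C} (a : U ⟶ V), R.η.app U ≫ R.F.map a = a ≫ R.η.app V :=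
      fun a => (R.η.naturality a).symm
    let t : Y ⟶ Pb := hpb.lift (g ≫ section_ f) (𝟙 _) (by simp)
    have t1 : t ≫ fst = g ≫ section_ f := by simp [t]
    have t2 : t ≫ snd = 𝟙 _ := by simp [t]
    let k := kernel.ι g
    have hkg : k ≫ g = 0 := kernel.condition g
    have kt1 : (k ≫ t) ≫ fst = 0 := by
      rw [Category.assoc, t1, ← Category.assoc, hkg, zero_comp]
    have hmono : Mono (k ≫ t) := by
      have : Mono ((k ≫ t) ≫ snd) := by
        rw [Category.assoc, t2, Category.comp_id]; infer_instance
      exact mono_of_mono _ snd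
    let ι := kernel.ι (R.F.map fst)
    let ι' := kernel.ι (R.F.map g)
    let κ₁ : kernel g ⟶ kernel (R.F.map fst) :=
      kernel.lift _ ((k ≫ t) ≫ R.η.app Pb) (by
        rw [Category.assoc, nat, ← Category.assoc, kt1, zero_comp])
    let κ₂ : kernel g ⟶ kernel (R.F.map g) :=
      kernel.lift _ (k ≫ R.η.app Y) (by
        rw [Category.assoc, nat, ← Category.assoc, hkg, zero_comp])
    have hκ₁ : κ₁ ≫ ι = (k ≫ t) ≫ R.η.app Pb := kernel.lift_ι _ _ _
    have hκ₂ : κ₂ ≫ ι' = k ≫ R.η.app Y := kernel.lift_ι _ _ _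
    have s₁ : StrongEpi κ₁ := by
      refine kernel_strong hC hfst (hB.pushout_units fst hfst) (k ≫ t) kt1 ?_ ι
        (kernel.condition _) κ₁ hκ₁
      intro W z hz
      refine ⟨kernel.lift g (z ≫ snd) ?_, ?_⟩
      · rw [Category.assoc, ← hpb.w, ← Category.assoc, hz, zero_comp]
      · apply hpb.hom_ext
        · rw [Category.assoc, kt1, comp_zero]; exact hz.symm
        · simp [k, t2]
    have s₂ : StrongEpi κ₂ := by
      refine kernel_strong hC hg (hB.pushout_units g hg) k hkg ?_ ι'
        (kernel.condition _) κ₂ hκ₂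
      intro W z hz
      exact ⟨kernel.lift g z hz, kernel.lift_ι _ _ _⟩
    let μ : kernel (R.F.map fst) ⟶ kernel (R.F.map g) :=
      kernel.lift _ (ι ≫ R.F.map snd) (by
        rw [Category.assoc, ← R.F.map_comp, ← hpb.w, R.F.map_comp, ← Category.assoc,
          kernel.condition, zero_comp])
    have hμ : μ ≫ ι' = ι ≫ R.F.map snd := kernel.lift_ι _ _ _
    have hκμ : κ₁ ≫ μ = κ₂ := by
      rw [← cancel_mono ι', Category.assoc, hμ, hκ₂, ← Category.assoc, hκ₁, Category.assoc, nat]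
      simp only [Category.assoc]
      rw [← Category.assoc t, t2, Category.id_comp]
    have sμ : StrongEpi μ := by
      have : StrongEpi (κ₁ ≫ μ) := by rw [hκμ]; exact s₂
      exact strongEpi_of_strongEpi κ₁ μ
    have hι : (ι ≫ R.F.map snd) ≫ R.F.map t = ι := by
      rw [← cancel_epi κ₁, ← Category.assoc, ← Category.assoc, hκ₁, Category.assoc, Category.assoc,
        ← R.F.map_comp, nat, Category.assoc, ← Category.assoc t, ← Category.assoc t, t2,
        Category.id_comp, Category.assoc]
    have mμ : Mono μ := by
      constructor
      intro W a b hab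
      have h1 := (hab =≫ ι') =≫ R.F.map t
      simp only [Category.assoc] at h1
      rw [← Category.assoc μ, hμ, hι] at h1
      exact (cancel_mono ι).1 h1
    have iμ : IsIso μ := isIso_of_mono_of_strongEpi μ
    have w : R.F.map fst ≫ R.F.map f = R.F.map snd ≫ R.F.map g := by
      rw [← R.F.map_comp, ← R.F.map_comp, hpb.w]
    let α := pullback.lift _ _ w
    have α1 : α ≫ pullback.fst _ _ = R.F.map fst := pullback.lift_fst _ _ _
    have α2 : α ≫ pullback.snd _ _ = R.F.map snd := pullback.lift_snd _ _ _
    have mα : Mono α := by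
      refine mono_of_ker hH.protomodular α ?_
      intro W z hz
      have z1 : z ≫ R.F.map fst = 0 := by rw [← α1, ← Category.assoc, hz, zero_comp]
      have z2 : z ≫ R.F.map snd = 0 := by rw [← α2, ← Category.assoc, hz, zero_comp]
      have hzι : kernel.lift _ z z1 ≫ ι = z := kernel.lift_ι _ _ _
      rw [← hzι, ← hι, ← Category.assoc, ← Category.assoc, hzι, z2, zero_comp]
    have sα : StrongEpi (α ≫ pullback.fst _ _) := by
      rw [α1]
      have : StrongEpi (R.η.app Pb ≫ R.F.map fst) := by
        rw [nat]; infer_instance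
      exact strongEpi_of_strongEpi (R.η.app Pb) _
    have iα : IsIso α := by
      refine iso_of_strong hH α (pullback.fst _ _) ?_
      intro W z hz
      have z2 : (z ≫ pullback.snd _ _) ≫ R.F.map g = 0 := by
        rw [Category.assoc, ← pullback.condition, ← Category.assoc, hz, zero_comp]
      refine ⟨kernel.lift _ _ z2 ≫ inv μ ≫ ι, ?_⟩
      apply pullback.hom_ext
      · rw [hz]
        simp only [Category.assoc, α1]
        simp [ι]
      · simp only [Category.assoc, α2]
        rw [← hμ]
        simp [ι']
    exact IsPullback.of_iso_pullback ⟨w⟩ (asIso α) α1 α2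
  refine ⟨main, ?_⟩
  obtain ⟨O, hO⟩ := HasZeroObject.zero (C := C)
  have hF0 : IsZero (R.F.obj O) := by
    rw [IsZero.iff_id_eq_zero, ← cancel_epi (R.η.app O)]
    exact hO.eq_of_src _ _
  have hT : PreservesLimitsOfShape (Discrete PEmpty.{1}) R.F := by
    have : PreservesLimit (Functor.empty.{0} C) R.F :=
      preservesLimit_of_preserves_limit_cone hO.isTerminal
        ((isLimitMapConeEmptyConeEquiv R.F O).symm hF0.isTerminal)
    exact preservesLimitsOfShape_pempty_of_preservesTerminal R.F
  have hBin : PreservesLimitsOfShape (Discrete WalkingPair) R.F := by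
    refine ⟨fun {K} => ?_⟩
    have key : PreservesLimit (pair (K.obj ⟨WalkingPair.left⟩) (K.obj ⟨WalkingPair.right⟩)) R.F := by
      generalize K.obj ⟨WalkingPair.left⟩ = X
      generalize K.obj ⟨WalkingPair.right⟩ = Y
      have hp : IsPullback (prod.fst : X ⨯ Y ⟶ X) prod.snd (0 : X ⟶ O) (0 : Y ⟶ O) := by
        refine ⟨⟨hO.eq_of_tgt _ _⟩, ⟨PullbackCone.IsLimit.mk _
          (fun s => prod.lift s.fst s.snd) (fun s => prod.lift_fst _ _)
          (fun s => prod.lift_snd _ _) ?_⟩⟩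
        intro s l h1 h2
        apply Limits.prod.hom_ext
        · rw [prod.lift_fst, h1]
        · rw [prod.lift_snd, h2]
      have hn : IsNormalEpiArrow (0 : Y ⟶ O) := by
        refine ⟨Y, 𝟙 Y, by simp, ⟨CokernelCofork.IsColimit.ofπ _ _ (fun _ _ => 0) ?_ ?_⟩⟩
        · intro W a ha
          simpa using ha.symm
        · intro W a ha l hl
          exact hO.eq_of_src _ _
      have hp' := main _ _ _ _ ⟨⟨⟨0, hO.eq_of_src _ _⟩⟩⟩ hn hp
      refine preservesLimit_of_preserves_limit_cone (prodIsProd X Y)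
        ((isLimitMapConeBinaryFanEquiv R.F _ _).symm ?_)
      refine BinaryFan.IsLimit.mk _ (fun a b => hp'.lift a b (hF0.eq_of_tgt _ _))
        (fun a b => hp'.lift_fst _ _ _) (fun a b => hp'.lift_snd _ _ _) ?_
      intro W a b l h1 h2
      apply hp'.hom_ext
      · rw [hp'.lift_fst]; exact h1
      · rw [hp'.lift_snd]; exact h2
    exact preservesLimit_of_iso_diagram R.F (diagramIsoPair K).symm
  exact PreservesFiniteProducts.of_preserves_binary_and_terminal R.F

end ProtoPaper
end

section
/- For a Birkhoff subcategory B of a semi-abelian category A with reflector I : A → B and associated radical [·]_B, the following conditions are equivalent: (1) I is protoadditive; (2) the radical [·]_B : A → A is protoadditive; (3) (a) for every normal epimorphism f : A → B the induced monomorphism [K[f]]_B → A is a normal monomorphism, and (b) the normal extensions with respect to I are precisely the normal epimorphisms f with K[f] ∈ B; (4) (a) for every normal epimorphism f : A → B the induced monomorphism [K[f]]_B → A is a normal monomorphism, and (b) for every normal epimorphism f : A → B the reflection of f into NExt_{(B,N)}(A) is given by the induced morphism A/[K[f]]_B → B. -/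
open CategoryTheory CategoryTheory.Limits

universe v u v₂ u₂

namespace ProtoPaper

variable {C : Type u} [Category.{v} C]

variable {P : C → Prop}

/-- The radical of a (normal epi)-reflection is protoadditive: any functor `T` with a
natural transformation `t : T ⟶ 𝟭` whose components are kernels of the units is
protoadditive. -/
def RadicalProtoadditive [HasZeroMorphisms C] {P : C → Prop} (R : Reflection C P) : Prop :=
  ∀ (T : C ⥤ C) (t : T ⟶ 𝟭 C),
    (∀ X : C, IsKernelOf (t.app X) (R.η.app X)) → IsProtoadditive T

/-- Condition (a) of Proposition 5.3: for every normal epimorphism `f` the induced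
monomorphism `[K[f]] ⟶ A` is normal. -/
def BirkhoffCondA [HasZeroMorphisms C] {P : C → Prop} (R : Reflection C P) : Prop :=
  ∀ ⦃A B : C⦄ (f : A ⟶ B), IsNormalEpiArrow f →
    ∀ ⦃K : C⦄ (k : K ⟶ A), IsKernelOf k f →
      ∀ ⦃TK : C⦄ (t : TK ⟶ K), IsKernelOf t (R.η.app K) →
        IsNormalMonoArrow (t ≫ k)

/-- Condition (3b) of Proposition 5.3: the normal extensions are exactly the normal
epimorphisms with kernel in the subcategory. -/
def BirkhoffCond3b [HasZeroMorphisms C] {P : C → Prop} (R : Reflection C P) : Prop :=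
  ∀ ⦃A B : C⦄ (f : A ⟶ B), IsNormalEpiArrow f →
    (IsNormalExtN R f ↔ ∃ (K : C) (k : K ⟶ A), IsKernelOf k f ∧ P K)

/-- Condition (4b) of Proposition 5.3: for every normal epimorphism `f : A ⟶ B`, the
induced morphism `A/[K[f]] ⟶ B` is the reflection of `f` into the subcategory of
normal extensions. -/
def BirkhoffCond4b [HasZeroMorphisms C] {P : C → Prop} (R : Reflection C P) : Prop :=
  ∀ ⦃A B : C⦄ (f : A ⟶ B), IsNormalEpiArrow f →
    ∀ ⦃K : C⦄ (k : K ⟶ A), IsKernelOf k f →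
      ∀ ⦃TK : C⦄ (t : TK ⟶ K), IsKernelOf t (R.η.app K) →
        ∀ ⦃Q : C⦄ (q : A ⟶ Q), IsCokernelOf q (t ≫ k) →
          ∀ (fbar : Q ⟶ B), q ≫ fbar = f →
            IsNormalExtN R fbar ∧
            ∀ ⦃X Y : C⦄ (g : X ⟶ Y), IsNormalExtN R g →
              ∀ (a : A ⟶ X) (b : B ⟶ Y), f ≫ b = a ≫ g →
                ∃! p : Q ⟶ X, q ≫ p = a ∧ fbar ≫ b = p ≫ g

section Helpers

variable [HasZeroMorphisms C]

lemma IsKernelOf.w {K A B : C} {k : K ⟶ A} {f : A ⟶ B} (h : IsKernelOf k f) : k ≫ f = 0 := h.1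

lemma IsKernelOf.mono {K A B : C} {k : K ⟶ A} {f : A ⟶ B} (h : IsKernelOf k f) : Mono k := by
  obtain ⟨w, ⟨l⟩⟩ := h
  exact mono_of_isLimit_fork l

lemma IsKernelOf.lift {K A B : C} {k : K ⟶ A} {f : A ⟶ B} (h : IsKernelOf k f)
    {X : C} (g : X ⟶ A) (hg : g ≫ f = 0) : ∃ l : X ⟶ K, l ≫ k = g := by
  obtain ⟨w, ⟨l⟩⟩ := h
  exact ⟨_, (KernelFork.IsLimit.lift' l g hg).2⟩

lemma IsKernelOf.mk {K A B : C} {k : K ⟶ A} {f : A ⟶ B} (w : k ≫ f = 0) (hm : Mono k)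
    (hl : ∀ ⦃X : C⦄ (g : X ⟶ A), g ≫ f = 0 → ∃ l : X ⟶ K, l ≫ k = g) : IsKernelOf k f :=
  ⟨w, ⟨KernelFork.IsLimit.ofι' k w fun g hg => ⟨(hl g hg).choose, (hl g hg).choose_spec⟩⟩⟩

lemma IsCokernelOf.w {K A B : C} {k : K ⟶ A} {f : A ⟶ B} (h : IsCokernelOf f k) : k ≫ f = 0 := h.1

lemma IsCokernelOf.epi {K A B : C} {k : K ⟶ A} {f : A ⟶ B} (h : IsCokernelOf f k) : Epi f := by
  obtain ⟨w, ⟨l⟩⟩ := h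
  exact epi_of_isColimit_cofork l

lemma IsCokernelOf.desc {K A B : C} {k : K ⟶ A} {f : A ⟶ B} (h : IsCokernelOf f k)
    {X : C} (g : A ⟶ X) (hg : k ≫ g = 0) : ∃ l : B ⟶ X, f ≫ l = g := by
  obtain ⟨w, ⟨l⟩⟩ := h
  exact ⟨_, (CokernelCofork.IsColimit.desc' l g hg).2⟩

lemma IsCokernelOf.mk {K A B : C} {k : K ⟶ A} {f : A ⟶ B} (w : k ≫ f = 0) (hm : Epi f)
    (hl : ∀ ⦃X : C⦄ (g : A ⟶ X), k ≫ g = 0 → ∃ l : B ⟶ X, f ≫ l = g) : IsCokernelOf f k :=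
  ⟨w, ⟨CokernelCofork.IsColimit.ofπ' f w fun g hg => ⟨(hl g hg).choose, (hl g hg).choose_spec⟩⟩⟩

lemma IsCokernelOf.isRegularEpi {K A B : C} {k : K ⟶ A} {f : A ⟶ B} (h : IsCokernelOf f k) :
    IsRegularEpi f := by
  obtain ⟨w, ⟨l⟩⟩ := h
  exact ⟨⟨⟨K, k, 0, by simpa using w, l⟩⟩⟩

lemma IsNormalEpiArrow.strongEpi {A B : C} {f : A ⟶ B} (h : IsNormalEpiArrow f) :
    StrongEpi f := by
  obtain ⟨K, k, h⟩ := h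
  have := h.isRegularEpi
  infer_instance

lemma ex_pullback [HasFiniteLimits C] {X Y Z : C} (f : X ⟶ Z) (g : Y ⟶ Z) :
    ∃ (Q : C) (p : Q ⟶ X) (q : Q ⟶ Y), IsPullback p q f g :=
  ⟨_, _, _, IsPullback.of_hasPullback f g⟩

lemma ex_kernel [HasFiniteLimits C] {X Y : C} (f : X ⟶ Y) :
    ∃ (K : C) (k : K ⟶ X), IsKernelOf k f :=
  ⟨kernel f, kernel.ι f, kernel.condition f, ⟨kernelIsKernel f⟩⟩

/-- The kernel of the projection from a pullback. -/
lemma kernel_of_pullback {Q X Y Z K : C} {p : Q ⟶ X} {q : Q ⟶ Y} {f : X ⟶ Z} {g : Y ⟶ Z}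
    (h : IsPullback p q f g) {k : K ⟶ Y} (hk : IsKernelOf k g) {k' : K ⟶ Q}
    (h1 : k' ≫ p = 0) (h2 : k' ≫ q = k) : IsKernelOf k' p := by
  have := hk.mono
  refine IsKernelOf.mk h1 ?_ ?_
  · rw [← h2] at this; exact mono_of_mono k' q
  · intro W a ha
    obtain ⟨l, hl⟩ := hk.lift (a ≫ q) (by rw [Category.assoc, ← h.w, reassoc_of% ha]; simp)
    refine ⟨l, h.hom_ext ?_ ?_⟩
    · simp [h1, ha]
    · simp [h2, hl]

lemma mono_iso_of_split (hP : IsProtomodular C) {K A B M : C} {k : K ⟶ A} {f : A ⟶ B} {s : B ⟶ A}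
    (h : IsSplitShortExact k f s) (m : M ⟶ A) [Mono m] (k' : K ⟶ M) (s' : B ⟶ M)
    (hk : k' ≫ m = k) (hs : s' ≫ m = s) : IsIso m := by
  have hkm := h.isKernel.mono
  refine hP k' (m ≫ f) s' k f s (𝟙 _) m (𝟙 _) ⟨IsKernelOf.mk ?_ ?_ ?_, ?_⟩ h
    (by simp [hk]) (by simp) (by simp [hs]) inferInstance inferInstance
  · rw [reassoc_of% hk, h.isKernel.w]
  · rw [← hk] at hkm; exact mono_of_mono k' m
  · intro X g hg
    obtain ⟨l, hl⟩ := h.isKernel.lift (g ≫ m) (by simpa using hg)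
    refine ⟨l, ?_⟩
    rw [← cancel_mono m, Category.assoc, hk, hl]
  · rw [reassoc_of% hs, h.split]

lemma split_hom_ext [HasFiniteLimits C] (hP : IsProtomodular C) {K A B X : C} {k : K ⟶ A}
    {f : A ⟶ B} {s : B ⟶ A} (h : IsSplitShortExact k f s) (a b : A ⟶ X)
    (h1 : k ≫ a = k ≫ b) (h2 : s ≫ a = s ≫ b) : a = b := by
  have : IsIso (equalizer.ι a b) :=
    mono_iso_of_split hP h _ (equalizer.lift k h1) (equalizer.lift s h2) (by simp) (by simp)
  rw [← cancel_epi (equalizer.ι a b), equalizer.condition]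

/-- Regular epimorphisms are cokernels of their kernels. -/
lemma isCokernelOf_kernel [HasFiniteLimits C] (hP : IsProtomodular C) {K A B : C} {k : K ⟶ A}
    {f : A ⟶ B} (hk : IsKernelOf k f) (hf : IsRegularEpi f) : IsCokernelOf f k := by
  refine IsCokernelOf.mk hk.w inferInstance ?_
  intro X g hg
  obtain ⟨Q, p, q, h⟩ := ex_pullback f f
  obtain ⟨k', h1, h2⟩ := h.exists_lift 0 k (by simp [hk.w])
  obtain ⟨d, d1, d2⟩ := h.exists_lift (𝟙 _) (𝟙 _) rfl
  have hpq : p ≫ g = q ≫ g := by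
    refine split_hom_ext hP ⟨kernel_of_pullback h hk h1 h2, d1⟩ _ _ ?_ ?_
    · rw [reassoc_of% h1, reassoc_of% h2, hg]; simp
    · rw [reassoc_of% d1, reassoc_of% d2]
  obtain ⟨r⟩ := hf
  obtain ⟨r⟩ := r
  obtain ⟨u, u1, u2⟩ := h.exists_lift r.left r.right r.w
  have : r.left ≫ g = r.right ≫ g := by rw [← u1, ← u2, Category.assoc, Category.assoc, hpq]
  exact ⟨_, (r.desc' g this).2⟩

lemma pullback_of_split [HasFiniteLimits C] (hP : IsProtomodular C) {K A B K' A' B' : C}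
    {k : K ⟶ A} {f : A ⟶ B} {s : B ⟶ A} {k' : K' ⟶ A'} {f' : A' ⟶ B'} {s' : B' ⟶ A'}
    (h : IsSplitShortExact k f s) (h' : IsSplitShortExact k' f' s')
    (κ : K ⟶ K') (α : A ⟶ A') (β : B ⟶ B') [IsIso κ]
    (e1 : k ≫ α = κ ≫ k') (e2 : f ≫ β = α ≫ f') (e3 : s ≫ α = β ≫ s') :
    IsPullback α f f' β := by
  obtain ⟨Q, p, q, hQ⟩ := ex_pullback f' β
  obtain ⟨c, c1, c2⟩ := hQ.exists_lift α f e2.symm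
  obtain ⟨j, j1, j2⟩ := hQ.exists_lift k' 0 (by simp [h'.isKernel.w])
  obtain ⟨t, t1, t2⟩ := hQ.exists_lift (β ≫ s') (𝟙 _) (by simp [h'.split])
  have : IsIso c := by
    refine hP k f s j q t κ c (𝟙 _) h ⟨kernel_of_pullback hQ.flip h'.isKernel j2 j1, t2⟩
      ?_ ?_ ?_ inferInstance inferInstance
    · apply hQ.hom_ext
      · simp [c1, j1, e1]
      · simp [c2, j2, h.isKernel.w]
    · simp [c2]
    · apply hQ.hom_ext
      · simp [c1, t1, e3]
      · simp [c2, t2, h.split]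
  exact hQ.of_iso (asIso c).symm (Iso.refl _) (Iso.refl _) (Iso.refl _) (by simp [c1])
    (by simp [c2]) (by simp) (by simp)

lemma retract_pullback {Q X Y Z Q' X' Y' Z' : C}
    {p : Q ⟶ X} {q : Q ⟶ Y} {f : X ⟶ Z} {g : Y ⟶ Z}
    {p' : Q' ⟶ X'} {q' : Q' ⟶ Y'} {f' : X' ⟶ Z'} {g' : Y' ⟶ Z'}
    (h : IsPullback p' q' f' g') (w : p ≫ f = q ≫ g)
    (iQ : Q ⟶ Q') (rQ : Q' ⟶ Q) (iX : X ⟶ X') (rX : X' ⟶ X) (iY : Y ⟶ Y') (rY : Y' ⟶ Y)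
    (iZ : Z ⟶ Z') (hQ : iQ ≫ rQ = 𝟙 _) (hX : iX ≫ rX = 𝟙 _) (hY : iY ≫ rY = 𝟙 _)
    (a1 : iQ ≫ p' = p ≫ iX) (a2 : iQ ≫ q' = q ≫ iY) (a3 : iX ≫ f' = f ≫ iZ)
    (a4 : iY ≫ g' = g ≫ iZ) (b1 : rQ ≫ p = p' ≫ rX) (b2 : rQ ≫ q = q' ≫ rY) :
    IsPullback p q f g := by
  refine IsPullback.mk' w ?_ ?_
  · intro T φ φ' h1 h2
    have : φ ≫ iQ = φ' ≫ iQ := by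
      apply h.hom_ext
      · simp [a1, reassoc_of% h1]
      · simp [a2, reassoc_of% h2]
    have := congrArg (fun x => x ≫ rQ) this
    simpa [hQ] using this
  · intro T a b hab
    obtain ⟨l, l1, l2⟩ := h.exists_lift (a ≫ iX) (b ≫ iY) (by
      simp [a3, a4, reassoc_of% hab])
    refine ⟨l ≫ rQ, ?_, ?_⟩
    · simp [b1, reassoc_of% l1, hX]
    · simp [b2, reassoc_of% l2, hY]

end Helpers

section Regular

variable [HasZeroMorphisms C] [HasZeroObject C] [HasFiniteLimits C]

lemma isRegularEpi_of_strongEpi (hH : IsHomological C) {X Y : C} (f : X ⟶ Y) [hf : StrongEpi f] :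
    IsRegularEpi f := by
  obtain ⟨I, e, m, ⟨he⟩, hm, rfl⟩ := hH.regEpiMonoFac f
  have : StrongEpi m := strongEpi_of_strongEpi e m
  have : IsIso m := isIso_of_mono_of_strongEpi m
  have i : Arrow.mk e ≅ Arrow.mk (e ≫ m) :=
    Arrow.isoMk (f := Arrow.mk e) (g := Arrow.mk (e ≫ m)) (Iso.refl X) (asIso m) (by simp)
  exact ⟨⟨RegularEpi.ofArrowIso i he⟩⟩

lemma strongEpi_pullback (hH : IsHomological C) {Q X Y Z : C} {p : Q ⟶ X} {q : Q ⟶ Y}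
    {f : X ⟶ Z} {g : Y ⟶ Z} (h : IsPullback p q f g) [StrongEpi f] : StrongEpi q := by
  have : IsRegularEpi q := ⟨hH.regEpiStable p q f g h (isRegularEpi_of_strongEpi hH f).1⟩
  infer_instance

lemma isNormalEpi_of_strongEpi (hH : IsHomological C) {X Y : C} (f : X ⟶ Y) [hf : StrongEpi f] :
    IsNormalEpiArrow f := by
  obtain ⟨K, k, hk⟩ := ex_kernel f
  exact ⟨K, k, isCokernelOf_kernel hH.protomodular hk (isRegularEpi_of_strongEpi hH f)⟩

/-- Short five lemma for monomorphisms into an extension. -/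
lemma mono_iso_of_regular (hH : IsHomological C) {K M A Z : C} {k : K ⟶ A} {q : A ⟶ Z}
    (hk : IsKernelOf k q) (m : M ⟶ A) [Mono m] (k' : K ⟶ M) (hk' : k' ≫ m = k)
    [StrongEpi (m ≫ q)] : IsIso m := by
  obtain ⟨X, a, b, hX⟩ := ex_pullback (m ≫ q) q
  obtain ⟨j, j1, j2⟩ := hX.exists_lift 0 k (by simp [hk.w])
  obtain ⟨s, s1, s2⟩ := hX.exists_lift (𝟙 _) m (by simp)
  obtain ⟨N, n, c, hN⟩ := ex_pullback b m
  have : Mono n := ⟨fun x y hxy => hN.hom_ext hxy (by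
    rw [← cancel_mono m, Category.assoc, Category.assoc, ← hN.w, reassoc_of% hxy])⟩
  obtain ⟨j', j'1, _⟩ := hN.exists_lift j k' (by rw [j2, hk'])
  obtain ⟨s', s'1, _⟩ := hN.exists_lift s (𝟙 _) (by simp [s2])
  have : IsIso n := mono_iso_of_split hH.protomodular ⟨kernel_of_pullback hX hk j1 j2, s1⟩ n j' s'
    j'1 s'1
  have : StrongEpi b := strongEpi_pullback hH hX
  have : StrongEpi (c ≫ m) := by rw [← hN.w]; infer_instance
  have : StrongEpi m := strongEpi_of_strongEpi c m
  exact isIso_of_mono_of_strongEpi m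

end Regular

section Functor

variable [HasZeroMorphisms C] [HasZeroObject C] [HasFiniteLimits C]

lemma radical_kernel (F : C ⥤ C) (e : ∀ A : C, A ⟶ F.obj A)
    (nat : ∀ ⦃A B : C⦄ (f : A ⟶ B), f ≫ e B = e A ≫ F.map f)
    (T : C ⥤ C) (t : ∀ A : C, T.obj A ⟶ A)
    (tnat : ∀ ⦃A B : C⦄ (f : A ⟶ B), T.map f ≫ t B = t A ≫ f)
    (ht : ∀ A, IsKernelOf (t A) (e A)) {K A B : C} {k : K ⟶ A} {f : A ⟶ B}
    (hk : IsKernelOf k f) (hm : Mono (F.map k)) : IsKernelOf (T.map k) (T.map f) := by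
  have hkm := hk.mono
  have hK := (ht K).mono
  have hA := (ht A).mono
  have hB := (ht B).mono
  refine IsKernelOf.mk ?_ ?_ ?_
  · rw [← cancel_mono (t B), Category.assoc, tnat, reassoc_of% (tnat k), hk.w]; simp
  · have : Mono (T.map k ≫ t A) := by rw [tnat]; infer_instance
    exact mono_of_mono _ (t A)
  · intro X x hx
    obtain ⟨y, hy⟩ := hk.lift (x ≫ t A) (by rw [Category.assoc, ← tnat, reassoc_of% hx]; simp)
    obtain ⟨z, hz⟩ := (ht K).lift y (by
      rw [← cancel_mono (F.map k), Category.assoc, ← nat, reassoc_of% hy, (ht A).w]; simp)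
    refine ⟨z, ?_⟩
    rw [← cancel_mono (t A), Category.assoc, tnat, reassoc_of% hz, hy]

lemma reflector_kernel (F : C ⥤ C) (e : ∀ A : C, A ⟶ F.obj A)
    (nat : ∀ ⦃A B : C⦄ (f : A ⟶ B), f ≫ e B = e A ≫ F.map f)
    (hH : IsHomological C) (he : ∀ A, StrongEpi (e A))
    (hF0 : ∀ X Y : C, F.map (0 : X ⟶ Y) = 0)
    (T : C ⥤ C) (t : ∀ A : C, T.obj A ⟶ A)
    (tnat : ∀ ⦃A B : C⦄ (f : A ⟶ B), T.map f ≫ t B = t A ≫ f)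
    (ht : ∀ A, IsKernelOf (t A) (e A)) {K A B : C} {k : K ⟶ A} {f : A ⟶ B} {s : B ⟶ A}
    (hk : IsSplitShortExact k f s) (hT : IsKernelOf (T.map k) (T.map f)) :
    IsKernelOf (F.map k) (F.map f) := by
  have hkm := hk.isKernel.mono
  obtain ⟨L, l, hl⟩ := ex_kernel (F.map f)
  have hlm := hl.mono
  obtain ⟨c, hc⟩ := hl.lift (k ≫ e A) (by
    rw [Category.assoc, ← nat, reassoc_of% hk.isKernel.w]; simp)
  obtain ⟨Q, p, q, hQ⟩ := ex_pullback (e B) (F.map f)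
  obtain ⟨d, d1, d2⟩ := hQ.exists_lift f (e A) (nat f)
  -- the comparison morphism `d` is a strong epimorphism
  have hd : StrongEpi d := by
    obtain ⟨M, r, m, ⟨hr⟩, hm, rm⟩ := hH.regEpiMonoFac d
    have : IsRegularEpi r := ⟨⟨hr⟩⟩
    obtain ⟨j, j1, j2⟩ := hQ.exists_lift (t B) 0 (by simp [(ht B).w])
    have hj : IsKernelOf j q := kernel_of_pullback hQ.flip (ht B) j2 j1
    have : StrongEpi (r ≫ (m ≫ q)) := by
      rw [reassoc_of% rm, d2]; exact he A
    have : StrongEpi (m ≫ q) := strongEpi_of_strongEpi r _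
    have : IsIso m := by
      refine mono_iso_of_regular hH hj m (T.map s ≫ t A ≫ r) ?_
      apply hQ.hom_ext
      · simp only [Category.assoc, reassoc_of% rm, d1, j1]
        rw [← tnat, ← T.map_comp_assoc, hk.split]; simp
      · simp only [Category.assoc, reassoc_of% rm, d2, j2, (ht A).w]; simp
    rw [← rm]; infer_instance
  obtain ⟨j, j1, j2⟩ := hQ.exists_lift 0 l (by simp [hl.w])
  have hcd : IsPullback k c d j := by
    refine IsPullback.mk' ?_ ?_ ?_
    · apply hQ.hom_ext
      · simp [d1, j1, hk.isKernel.w]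
      · simp [d2, j2, hc]
    · intro X x y hxy _
      rwa [cancel_mono] at hxy
    · intro X x y hxy
      have h1 := congrArg (fun z => z ≫ p) hxy
      have h2 := congrArg (fun z => z ≫ q) hxy
      simp only [Category.assoc, d1, j1, comp_zero] at h1
      simp only [Category.assoc, d2, j2] at h2
      obtain ⟨z, hz⟩ := hk.isKernel.lift x h1
      refine ⟨z, hz, ?_⟩
      rw [← cancel_mono l, Category.assoc, hc, reassoc_of% hz, h2]
  have hcs : StrongEpi c := strongEpi_pullback hH hcd
  -- the kernel of `c` is the radical of `K`
  have htK : IsKernelOf (t K) c := by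
    refine IsKernelOf.mk ?_ (ht K).mono ?_
    · rw [← cancel_mono l, Category.assoc, hc, nat, reassoc_of% (ht K).w]; simp
    · intro X x hx
      obtain ⟨y, hy⟩ := (ht A).lift (x ≫ k) (by rw [Category.assoc, ← hc, reassoc_of% hx]; simp)
      have := (ht B).mono
      obtain ⟨z, hz⟩ := hT.lift y (by
        rw [← cancel_mono (t B), Category.assoc, tnat, reassoc_of% hy, hk.isKernel.w]; simp)
      refine ⟨z, ?_⟩
      rw [← cancel_mono k, Category.assoc, ← tnat, reassoc_of% hz, hy]
  have hc1 := isCokernelOf_kernel hH.protomodular htK (isRegularEpi_of_strongEpi hH c)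
  have := he K
  have hc2 := isCokernelOf_kernel hH.protomodular (ht K) (isRegularEpi_of_strongEpi hH (e K))
  obtain ⟨v, hv⟩ := hc1.desc (e K) (ht K).w
  obtain ⟨u, hu⟩ := hc2.desc c htK.w
  have hul : u ≫ l = F.map k := by
    rw [← cancel_epi (e K), reassoc_of% hu, hc, nat]
  have huv : u ≫ v = 𝟙 _ := by rw [← cancel_epi (e K), reassoc_of% hu, hv]; simp
  have hvu : v ≫ u = 𝟙 _ := by rw [← cancel_epi c, reassoc_of% hv, hu]; simp
  refine IsKernelOf.mk ?_ ?_ ?_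
  · rw [← F.map_comp, hk.isKernel.w, hF0]
  · rw [← hul]
    have : IsIso u := ⟨v, huv, hvu⟩
    infer_instance
  · intro X x hx
    obtain ⟨y, hy⟩ := hl.lift x hx
    refine ⟨y ≫ v, ?_⟩
    rw [← hul, Category.assoc, reassoc_of% hvu, hy]

lemma normal_of_protoadditive (F : C ⥤ C) (e : ∀ A : C, A ⟶ F.obj A)
    (nat : ∀ ⦃A B : C⦄ (f : A ⟶ B), f ≫ e B = e A ≫ F.map f)
    (hC : IsSemiAbelian C) (hF : IsProtoadditive F)
    {K A B TK : C} {k : K ⟶ A} {f : A ⟶ B} (hk : IsKernelOf k f) {t : TK ⟶ K}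
    (ht : IsKernelOf t (e K)) : IsNormalMonoArrow (t ≫ k) := by
  have hkm := hk.mono
  have htm := ht.mono
  have hP := hC.homological.protomodular
  obtain ⟨Rl, p, q, hR⟩ := ex_pullback f f
  obtain ⟨κ, κ1, κ2⟩ := hR.exists_lift 0 k (by simp [hk.w])
  obtain ⟨δ, δ1, δ2⟩ := hR.exists_lift (𝟙 _) (𝟙 _) rfl
  obtain ⟨σ, σ1, σ2⟩ := hR.exists_lift q p hR.w.symm
  have hκ : IsSplitShortExact κ p δ := ⟨kernel_of_pullback hR hk κ1 κ2, δ1⟩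
  have hFκ := hF _ _ _ hκ
  have hFκm := hFκ.isKernel.mono
  have Fδp : F.map δ ≫ F.map p = 𝟙 _ := hFκ.split
  have Fδq : F.map δ ≫ F.map q = 𝟙 _ := by rw [← F.map_comp, δ2, F.map_id]
  have δσ : δ ≫ σ = δ := by
    apply hR.hom_ext <;> simp [σ1, σ2, δ1, δ2]
  -- the relation
  obtain ⟨S, i, z, hS⟩ := ex_pullback (e Rl) (F.map δ)
  have hz1 : z = i ≫ p ≫ e A := by
    rw [nat, reassoc_of% hS.w, Fδp]; simp
  have hz2 : z = i ≫ q ≫ e A := by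
    rw [nat, reassoc_of% hS.w, Fδq]; simp
  have hi : Mono i := ⟨fun x y hxy => hS.hom_ext hxy (by rw [hz1, reassoc_of% hxy])⟩
  have hrel : IsInternalEquivRel (i ≫ p) (i ≫ q) := by
    refine ⟨?_, ?_, ?_, ?_⟩
    · intro Z a b h1 h2
      rw [← cancel_mono i]
      apply hR.hom_ext <;> simpa
    · obtain ⟨d, d1, d2⟩ := hS.exists_lift δ (e A) (nat δ)
      exact ⟨d, by rw [reassoc_of% d1, δ1], by rw [reassoc_of% d1, δ2]⟩
    · obtain ⟨d, d1, d2⟩ := hS.exists_lift (i ≫ σ) z (by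
        rw [Category.assoc, nat, reassoc_of% hS.w, ← F.map_comp, δσ])
      exact ⟨d, by rw [reassoc_of% d1, σ1], by rw [reassoc_of% d1, σ2]⟩
    · intro Pb q1 q2 hPb
      have hw : q1 ≫ i ≫ q = q2 ≫ i ≫ p := hPb.w
      obtain ⟨R2, r1, r2, hR2⟩ := ex_pullback q p
      obtain ⟨k2, k21, k22⟩ := hR2.exists_lift 0 κ (by simp [κ1])
      obtain ⟨s2, s21, s22⟩ := hR2.exists_lift (𝟙 _) (q ≫ δ) (by simp [δ1])
      have hs2 : IsSplitShortExact k2 r1 s2 := ⟨kernel_of_pullback hR2 hκ.isKernel k21 k22, s21⟩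
      have hpb := pullback_of_split hP (hF _ _ _ hs2) hFκ (𝟙 _) (F.map r2) (F.map q)
        (by rw [← F.map_comp, k22]; simp) (by rw [← F.map_comp, ← F.map_comp, hR2.w])
        (by rw [← F.map_comp, ← F.map_comp, s22])
      obtain ⟨ρ, ρ1, ρ2⟩ := hR2.exists_lift (q1 ≫ i) (q2 ≫ i) (by simpa using hw)
      obtain ⟨τ, τ1, τ2⟩ := hR.exists_lift (r1 ≫ p) (r2 ≫ q) (by
        rw [Category.assoc, Category.assoc, hR.w, reassoc_of% hR2.w, hR.w])
      obtain ⟨δ', δ'1, δ'2⟩ := hR2.exists_lift δ δ (by rw [δ1, δ2])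
      have hδτ : δ' ≫ τ = δ := by
        apply hR.hom_ext
        · simp [τ1, reassoc_of% δ'1]
        · simp [τ2, reassoc_of% δ'2]
      have hzz : q2 ≫ z = q1 ≫ z := by
        conv_rhs => rw [hz2, reassoc_of% hw]
        rw [hz1]
      have key : ρ ≫ e R2 = q1 ≫ z ≫ F.map δ' := by
        apply hpb.hom_ext
        · simp only [Category.assoc]
          rw [← nat, reassoc_of% ρ2, hS.w, ← F.map_comp, δ'2, reassoc_of% hzz]
        · simp only [Category.assoc]
          rw [← nat, reassoc_of% ρ1, hS.w, ← F.map_comp, δ'1]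
      obtain ⟨u, u1, u2⟩ := hS.exists_lift (ρ ≫ τ) (q1 ≫ z) (by
        rw [Category.assoc, nat, reassoc_of% key, ← F.map_comp, hδτ, Category.assoc])
      refine ⟨u, ?_, ?_⟩
      · rw [reassoc_of% u1, τ1, reassoc_of% ρ1]
      · rw [reassoc_of% u1, τ2, reassoc_of% ρ2]
  obtain ⟨Y, g, hg⟩ := hC.equivRelEffective _ _ hrel
  refine ⟨Y, g, IsKernelOf.mk ?_ inferInstance ?_⟩
  · obtain ⟨u, u1, u2⟩ := hS.exists_lift (t ≫ κ) 0 (by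
      rw [Category.assoc, nat, reassoc_of% ht.w]; simp)
    have := congrArg (fun x => u ≫ x) hg.w
    simp only [Category.assoc, reassoc_of% u1, reassoc_of% κ1, reassoc_of% κ2] at this
    simpa using this.symm
  · intro X x hx
    obtain ⟨v, v1, v2⟩ := hg.exists_lift 0 x (by simp [hx])
    obtain ⟨w, hw⟩ := hκ.isKernel.lift (v ≫ i) (by simpa using v1)
    have hvz : v ≫ z = 0 := by
      rw [hz1]
      simp only [← Category.assoc] at v1 ⊢
      rw [v1]; simp
    obtain ⟨y, hy⟩ := ht.lift w (by
      rw [← cancel_mono (F.map κ), Category.assoc, ← nat, reassoc_of% hw, hS.w, reassoc_of% hvz]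
      simp)
    refine ⟨y, ?_⟩
    rw [reassoc_of% hy, ← v2, ← Category.assoc, ← hw, Category.assoc, κ2]

end Functor

section Quotients

variable [HasZeroMorphisms C]

lemma kernel_of_pullback' {Q X Y Z K : C} {p : Q ⟶ X} {q : Q ⟶ Y} {f : X ⟶ Z} {g : Y ⟶ Z}
    (h : IsPullback p q f g) {k : K ⟶ Q} (hk : IsKernelOf k q) : IsKernelOf (k ≫ p) f := by
  have hkm := hk.mono
  refine IsKernelOf.mk ?_ ⟨fun x y hxy => ?_⟩ ?_
  · rw [Category.assoc, h.w, reassoc_of% hk.w]; simp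
  · rw [← cancel_mono k]
    apply h.hom_ext
    · simpa using hxy
    · simp [hk.w]
  · intro W a ha
    obtain ⟨l, l1, l2⟩ := h.exists_lift a 0 (by simp [ha])
    obtain ⟨y, hy⟩ := hk.lift l l2
    exact ⟨y, by rw [reassoc_of% hy, l1]⟩

lemma kernel_of_cokernel {N A Q : C} {n : N ⟶ A} {q : A ⟶ Q} (hn : IsNormalMonoArrow n)
    (hq : IsCokernelOf q n) : IsKernelOf n q := by
  obtain ⟨Y, g, hg⟩ := hn
  obtain ⟨g', hg'⟩ := hq.desc g hg.w
  refine IsKernelOf.mk hq.w hg.mono ?_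
  intro X x hx
  exact hg.lift x (by rw [← hg', reassoc_of% hx]; simp)

variable [HasZeroObject C] [HasFiniteLimits C]

lemma ex_quotient (hH : IsHomological C) {N A : C} {n : N ⟶ A} (hn : IsNormalMonoArrow n) :
    ∃ (Q : C) (q : A ⟶ Q), StrongEpi q ∧ IsKernelOf n q := by
  obtain ⟨Y, g, hg⟩ := hn
  obtain ⟨I, r, m, ⟨hr⟩, hm, rfl⟩ := hH.regEpiMonoFac g
  have : IsRegularEpi r := ⟨⟨hr⟩⟩
  refine ⟨I, r, inferInstance, IsKernelOf.mk ?_ hg.mono ?_⟩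
  · rw [← cancel_mono m, Category.assoc, hg.w]; simp
  · intro X x hx
    exact hg.lift x (by rw [reassoc_of% hx]; simp)

lemma quotient_kernel (hH : IsHomological C) {K A B TK U Q : C} {k : K ⟶ A} {f : A ⟶ B}
    (hk : IsKernelOf k f) {t : TK ⟶ K} {u : K ⟶ U} (hu : StrongEpi u) (ht : IsKernelOf t u)
    {q : A ⟶ Q} (hqe : StrongEpi q) (hq : IsKernelOf (t ≫ k) q) {fbar : Q ⟶ B}
    (hf : q ≫ fbar = f) : ∃ j : U ⟶ Q, u ≫ j = k ≫ q ∧ IsKernelOf j fbar := by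
  have hkm := hk.mono
  obtain ⟨L, l, hl⟩ := ex_kernel fbar
  have hlm := hl.mono
  obtain ⟨c, hc⟩ := hl.lift (k ≫ q) (by rw [Category.assoc, hf, hk.w])
  have hpb : IsPullback k c q l := by
    refine IsPullback.mk' hc.symm ?_ ?_
    · intro X x y hxy _
      rwa [cancel_mono] at hxy
    · intro X x y hxy
      obtain ⟨z, hz⟩ := hk.lift x (by rw [← hf, reassoc_of% hxy, hl.w]; simp)
      refine ⟨z, hz, ?_⟩
      rw [← cancel_mono l, Category.assoc, hc, reassoc_of% hz, hxy]
  have hcs : StrongEpi c := strongEpi_pullback hH hpb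
  have htc : IsKernelOf t c := by
    refine IsKernelOf.mk ?_ ht.mono ?_
    · rw [← cancel_mono l, Category.assoc, hc, ← Category.assoc, hq.w]; simp
    · intro X x hx
      obtain ⟨y, hy⟩ := hq.lift (x ≫ k) (by rw [Category.assoc, ← hc, reassoc_of% hx]; simp)
      refine ⟨y, ?_⟩
      rw [← cancel_mono k, Category.assoc, hy]
  have hc1 := isCokernelOf_kernel hH.protomodular htc (isRegularEpi_of_strongEpi hH c)
  have hc2 := isCokernelOf_kernel hH.protomodular ht (isRegularEpi_of_strongEpi hH u)
  obtain ⟨v, hv⟩ := hc1.desc u ht.w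
  obtain ⟨w, hw⟩ := hc2.desc c htc.w
  have hwv : w ≫ v = 𝟙 _ := by rw [← cancel_epi u, reassoc_of% hw, hv]; simp
  have hvw : v ≫ w = 𝟙 _ := by rw [← cancel_epi c, reassoc_of% hv, hw]; simp
  have : IsIso w := ⟨v, hwv, hvw⟩
  refine ⟨w ≫ l, by rw [reassoc_of% hw, hc], IsKernelOf.mk ?_ inferInstance ?_⟩
  · simp [hl.w]
  · intro X x hx
    obtain ⟨y, hy⟩ := hl.lift x hx
    exact ⟨y ≫ v, by rw [Category.assoc, reassoc_of% hvw, hy]⟩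

end Quotients

section Reflections

variable [HasZeroMorphisms C]

lemma Reflection.nat (R : Reflection C P) {A B : C} (f : A ⟶ B) :
    f ≫ (R.η.app B : B ⟶ R.F.obj B) = (R.η.app A : A ⟶ R.F.obj A) ≫ R.F.map f :=
  R.η.naturality f

lemma Reflection.map_zero' (R : Reflection C P)
    (he : ∀ A, StrongEpi (R.η.app A : A ⟶ R.F.obj A)) (X Y : C) :
    R.F.map (0 : X ⟶ Y) = 0 := by
  have := he X
  rw [← cancel_epi (R.η.app X : X ⟶ R.F.obj X), ← R.nat]; simp

lemma Reflection.isIso_unit (R : Reflection C P)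
    (he : ∀ A, StrongEpi (R.η.app A : A ⟶ R.F.obj A)) {X : C} (hX : P X) :
    IsIso (R.η.app X : X ⟶ R.F.obj X) := by
  have := he X
  obtain ⟨g, hg, -⟩ := R.univ hX (𝟙 X)
  have hg' : (R.η.app X : X ⟶ R.F.obj X) ≫ g = 𝟙 X := hg
  exact ⟨g, hg', by
    rw [← cancel_epi (R.η.app X : X ⟶ R.F.obj X), reassoc_of% hg']; simp⟩

lemma Reflection.mem_kernel (hrepl : Replete P) (R : Reflection C P)
    (he : ∀ A, StrongEpi (R.η.app A : A ⟶ R.F.obj A)) {L X Y : C} {l : L ⟶ X} {g : X ⟶ Y}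
    (hl : IsKernelOf l g) (hX : P X) : P L := by
  have := he L
  have hlm := hl.mono
  obtain ⟨h, hh, -⟩ := R.univ hX l
  have hh' : (R.η.app L : L ⟶ R.F.obj L) ≫ h = l := hh
  obtain ⟨h', hh''⟩ := hl.lift h (by
    rw [← cancel_epi (R.η.app L : L ⟶ R.F.obj L), reassoc_of% hh', hl.w]; simp)
  have h1 : (R.η.app L : L ⟶ R.F.obj L) ≫ h' = 𝟙 L := by
    rw [← cancel_mono l, Category.assoc, hh'', hh']; simp
  have h2 : h' ≫ (R.η.app L : L ⟶ R.F.obj L) = 𝟙 _ := by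
    rw [← cancel_epi (R.η.app L : L ⟶ R.F.obj L), reassoc_of% h1]; simp
  exact hrepl (R.mem L) ⟨h', R.η.app L, h2, h1⟩

lemma Reflection.mem_of_normalExt (hrepl : Replete P) (R : Reflection C P)
    (he : ∀ A, StrongEpi (R.η.app A : A ⟶ R.F.obj A)) {K A B : C} {k : K ⟶ A} {f : A ⟶ B}
    (hk : IsKernelOf k f) (hf : IsNormalExtN R f) : P K := by
  obtain ⟨-, Pb, p1, p2, hpb, htriv⟩ := hf
  obtain ⟨κ, κ1, κ2⟩ := hpb.exists_lift 0 k (by simp [hk.w])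
  exact R.mem_kernel hrepl he (kernel_of_pullback' htriv (kernel_of_pullback hpb hk κ1 κ2))
    (R.mem Pb)

variable [HasZeroObject C] [HasFiniteLimits C]

lemma Reflection.normalExt_of_protoadditive (hH : IsHomological C) (R : Reflection C P)
    (he : ∀ A, StrongEpi (R.η.app A : A ⟶ R.F.obj A)) (hF : IsProtoadditive R.F)
    {K A B : C} {k : K ⟶ A} {f : A ⟶ B} (hf : IsNormalEpiArrow f)
    (hk : IsKernelOf k f) (hK : P K) : IsNormalExtN R f := by
  obtain ⟨Pb, p, q, hpb⟩ := ex_pullback f f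
  obtain ⟨κ, κ1, κ2⟩ := hpb.exists_lift 0 k (by simp [hk.w])
  obtain ⟨δ, δ1, δ2⟩ := hpb.exists_lift (𝟙 _) (𝟙 _) rfl
  have hκ : IsSplitShortExact κ p δ := ⟨kernel_of_pullback hpb hk κ1 κ2, δ1⟩
  have := R.isIso_unit he hK
  exact ⟨hf, Pb, p, q, hpb, pullback_of_split hH.protomodular hκ (hF _ _ _ hκ)
    (R.η.app K : K ⟶ R.F.obj K) (R.η.app Pb) (R.η.app A) (R.nat κ) (R.nat p) (R.nat δ)⟩

lemma Reflection.protoadditive_of_cond (hH : IsHomological C) (R : Reflection C P)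
    (he : ∀ A, StrongEpi (R.η.app A : A ⟶ R.F.obj A)) (ha : BirkhoffCondA R)
    (hb : BirkhoffCond3b R) : IsProtoadditive R.F := by
  intro K A B k f s hk
  have hsplit : R.F.map s ≫ R.F.map f = 𝟙 _ := by rw [← R.F.map_comp, hk.split, R.F.map_id]
  refine ⟨?_, hsplit⟩
  have : IsSplitEpi f := ⟨⟨⟨s, hk.split⟩⟩⟩
  have hfn : IsNormalEpiArrow f := isNormalEpi_of_strongEpi hH f
  obtain ⟨TK, t, ht⟩ := ex_kernel (R.η.app K : K ⟶ R.F.obj K)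
  obtain ⟨Q, r, hr, hrk⟩ := ex_quotient hH (ha f hfn k hk.isKernel t ht)
  have hrc := isCokernelOf_kernel hH.protomodular hrk (isRegularEpi_of_strongEpi hH r)
  obtain ⟨fbar, hfbar⟩ := hrc.desc f (by rw [Category.assoc, hk.isKernel.w]; simp)
  obtain ⟨j, hj1, hj⟩ := quotient_kernel hH hk.isKernel (he K) ht hr hrk hfbar
  have hsb : (s ≫ r) ≫ fbar = 𝟙 _ := by rw [Category.assoc, hfbar, hk.split]
  have : IsSplitEpi fbar := ⟨⟨⟨s ≫ r, hsb⟩⟩⟩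
  obtain ⟨-, Pb, p1, p2, hpb, htriv⟩ :=
    (hb fbar (isNormalEpi_of_strongEpi hH fbar)).2 ⟨_, j, hj, R.mem K⟩
  obtain ⟨i, i1, i2⟩ := hpb.exists_lift (fbar ≫ s ≫ r) (𝟙 _) (by
    rw [Category.assoc, hsb]; simp)
  have htriv' : IsPullback (R.η.app Q : Q ⟶ R.F.obj Q) fbar (R.F.map fbar) (R.η.app B) := by
    refine retract_pullback htriv (R.nat fbar).symm i p2 (R.F.map i) (R.F.map p2) (s ≫ r) fbar
      (R.F.map (s ≫ r)) i2 ?_ hsb (R.nat i) i1 ?_ (R.nat _) (R.nat p2) hpb.w.symm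
    · rw [← R.F.map_comp, i2, R.F.map_id]
    · rw [← R.F.map_comp, ← R.F.map_comp, i1]
  have hker := kernel_of_pullback' htriv' hj
  have heA := he A
  have heK := he K
  have heQ := he Q
  obtain ⟨w, hw⟩ := hrc.desc (R.η.app A : A ⟶ R.F.obj A) (by
    rw [Category.assoc, R.nat k, reassoc_of% ht.w]; simp)
  obtain ⟨w', hw', -⟩ := R.univ (R.mem A) w
  replace hw' : (R.η.app Q : Q ⟶ R.F.obj Q) ≫ w' = w := hw'
  have e1 : R.F.map r ≫ w' = 𝟙 _ := by
    rw [← cancel_epi (R.η.app A : A ⟶ R.F.obj A), ← Category.assoc, ← R.nat, Category.assoc, hw',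
      hw]
    simp
  have e2 : w' ≫ R.F.map r = 𝟙 _ := by
    rw [← cancel_epi (R.η.app Q : Q ⟶ R.F.obj Q), reassoc_of% hw', ← cancel_epi r,
      reassoc_of% hw, ← R.nat]
    simp
  have hiso : IsIso (R.F.map r) := ⟨w', e1, e2⟩
  have hkr : R.F.map k ≫ R.F.map r = j ≫ (R.η.app Q : Q ⟶ R.F.obj Q) := by
    rw [← cancel_epi (R.η.app K : K ⟶ R.F.obj K), ← Category.assoc, ← R.nat, Category.assoc,
      ← R.nat, reassoc_of% hj1]
  have hrf : R.F.map r ≫ R.F.map fbar = R.F.map f := by rw [← R.F.map_comp, hfbar]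
  refine IsKernelOf.mk ?_ ?_ ?_
  · rw [← R.F.map_comp, hk.isKernel.w, R.map_zero' he]
  · have := hker.mono
    rw [← hkr] at this
    exact mono_of_mono _ (R.F.map r)
  · intro X x hx
    obtain ⟨y, hy⟩ := hker.lift (x ≫ R.F.map r) (by rw [Category.assoc, hrf, hx])
    refine ⟨y, ?_⟩
    rw [← cancel_mono (R.F.map r), Category.assoc, hkr, hy]

lemma Reflection.cond4b_of_cond (hH : IsHomological C) (hrepl : Replete P) (R : Reflection C P)
    (he : ∀ A, StrongEpi (R.η.app A : A ⟶ R.F.obj A)) (ha : BirkhoffCondA R)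
    (hb : BirkhoffCond3b R) : BirkhoffCond4b R := by
  intro A B f hf K k hk TK t ht Q q hq fbar hfbar
  have hfs := hf.strongEpi
  have hqe := hq.epi
  have hqs : StrongEpi q := IsNormalEpiArrow.strongEpi ⟨_, _, hq⟩
  have hqk := kernel_of_cokernel (ha f hf k hk t ht) hq
  obtain ⟨j, hj1, hj⟩ := quotient_kernel hH hk (he K) ht hqs hqk hfbar
  have : StrongEpi (q ≫ fbar) := by rwa [hfbar]
  have : StrongEpi fbar := strongEpi_of_strongEpi q fbar
  refine ⟨(hb fbar (isNormalEpi_of_strongEpi hH fbar)).2 ⟨_, j, hj, R.mem K⟩, ?_⟩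
  intro X Y g hg a b hab
  obtain ⟨L, l, hl⟩ := ex_kernel g
  have hL := R.mem_of_normalExt hrepl he hl hg
  obtain ⟨c, hc⟩ := hl.lift (k ≫ a) (by
    rw [Category.assoc, ← hab, reassoc_of% hk.w]; simp)
  obtain ⟨c', hc', -⟩ := R.univ hL c
  replace hc' : (R.η.app K : K ⟶ R.F.obj K) ≫ c' = c := hc'
  have htw : t ≫ (R.η.app K : K ⟶ R.F.obj K) = 0 := ht.w
  obtain ⟨p, hp⟩ := hq.desc a (by
    rw [Category.assoc, ← hc, ← hc', Category.assoc, reassoc_of% htw]; simp)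
  refine ⟨p, ⟨hp, ?_⟩, ?_⟩
  · rw [← cancel_epi q, reassoc_of% hfbar, reassoc_of% hp, hab]
  · rintro p' ⟨hp', -⟩
    rw [← cancel_epi q, hp, hp']

lemma Reflection.cond3b_of_cond4b (hrepl : Replete P) (R : Reflection C P)
    (he : ∀ A, StrongEpi (R.η.app A : A ⟶ R.F.obj A))
    (hb : BirkhoffCond4b R) : BirkhoffCond3b R := by
  intro A B f hf
  constructor
  · intro h
    obtain ⟨K, k, hk⟩ := ex_kernel f
    exact ⟨K, k, hk, R.mem_of_normalExt hrepl he hk h⟩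
  · rintro ⟨K, k, hk, hK⟩
    have := R.isIso_unit he hK
    obtain ⟨TK, t, ht⟩ := ex_kernel (R.η.app K : K ⟶ R.F.obj K)
    have ht0 : t = 0 := by
      rw [← cancel_mono (R.η.app K : K ⟶ R.F.obj K), ht.w]; simp
    refine (hb f hf k hk t ht (𝟙 A) (IsCokernelOf.mk ?_ inferInstance ?_) f (by simp)).1
    · simp [ht0]
    · intro X g _
      exact ⟨g, by simp⟩

/-- The radical functor associated with a reflection. -/
noncomputable def Reflection.radical (R : Reflection C P) : C ⥤ C where
  obj X := kernel (R.η.app X : X ⟶ R.F.obj X)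
  map {X Y} f := kernel.map (R.η.app X : X ⟶ R.F.obj X) (R.η.app Y : Y ⟶ R.F.obj Y) f (R.F.map f)
    (R.nat f).symm
  map_id X := by
    rw [← cancel_mono (kernel.ι (R.η.app X : X ⟶ R.F.obj X))]; simp
  map_comp {X Y Z} f g := by
    rw [← cancel_mono (kernel.ι (R.η.app Z : Z ⟶ R.F.obj Z))]; simp

/-- The inclusion of the radical. -/
noncomputable def Reflection.radicalι (R : Reflection C P) : R.radical ⟶ 𝟭 C where
  app X := kernel.ι (R.η.app X : X ⟶ R.F.obj X)
  naturality X Y f := by simp [Reflection.radical]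

end Reflections

/-- Proposition 5.3. For a Birkhoff subcategory of a semi-abelian
category with reflector `R`, the following are equivalent: (1) `R` is protoadditive;
(2) the associated radical is protoadditive; (3) conditions (a) and (3b);
(4) conditions (a) and (4b). -/
theorem statement18 {C : Type u} [Category.{v} C] [HasZeroObject C] [HasZeroMorphisms C]
    (hC : IsSemiAbelian C) {P : C → Prop} (hrepl : Replete P)
    (R : Reflection C P) (hB : IsBirkhoff R) :
    (IsProtoadditive R.F ↔ RadicalProtoadditive R)
    ∧ (IsProtoadditive R.F ↔ (BirkhoffCondA R ∧ BirkhoffCond3b R))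
    ∧ (IsProtoadditive R.F ↔ (BirkhoffCondA R ∧ BirkhoffCond4b R)) := by
  have hH := hC.homological
  have := hH.hasFiniteLimits
  have he : ∀ A, StrongEpi (R.η.app A : A ⟶ R.F.obj A) := fun A => by
    have : IsRegularEpi (R.η.app A : A ⟶ R.F.obj A) := ⟨hB.units_regEpi A⟩
    infer_instance
  have h13 : IsProtoadditive R.F → BirkhoffCondA R ∧ BirkhoffCond3b R := by
    intro hF
    refine ⟨?_, ?_⟩
    · intro A B f _ K k hk TK t ht
      exact normal_of_protoadditive R.F (fun A => R.η.app A) (fun _ _ f => R.nat f) hC hF hk ht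
    · intro A B f hf
      constructor
      · intro h
        obtain ⟨K, k, hk⟩ := ex_kernel f
        exact ⟨K, k, hk, R.mem_of_normalExt hrepl he hk h⟩
      · rintro ⟨K, k, hk, hK⟩
        exact R.normalExt_of_protoadditive hH he hF hf hk hK
  refine ⟨⟨?_, ?_⟩, ⟨h13, fun h => R.protoadditive_of_cond hH he h.1 h.2⟩, ⟨?_, ?_⟩⟩
  · intro hF T t ht K A B k f s hk
    refine ⟨radical_kernel R.F (fun A => R.η.app A) (fun _ _ f => R.nat f) T (fun A => t.app A)
      (fun _ _ f => t.naturality f) ht hk.isKernel (hF _ _ _ hk).isKernel.mono, ?_⟩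
    rw [← T.map_comp, hk.split, T.map_id]
  · intro hT K A B k f s hk
    have ht : ∀ X : C, IsKernelOf (R.radicalι.app X) (R.η.app X) := fun X =>
      ⟨kernel.condition _, ⟨kernelIsKernel _⟩⟩
    refine ⟨reflector_kernel R.F (fun A => R.η.app A) (fun _ _ f => R.nat f) hH he
      (R.map_zero' he) R.radical (fun A => R.radicalι.app A)
      (fun _ _ f => R.radicalι.naturality f) ht hk (hT _ _ ht _ _ _ hk).isKernel, ?_⟩
    rw [← R.F.map_comp, hk.split, R.F.map_id]
  · intro hF
    exact ⟨(h13 hF).1, R.cond4b_of_cond hH hrepl he (h13 hF).1 (h13 hF).2⟩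
  · rintro ⟨ha, hb⟩
    exact R.protoadditive_of_cond hH he ha (R.cond3b_of_cond4b hrepl he hb)

end ProtoPaper
end
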